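/- arXiv:2407.10843 — 7 statements merged into one kernel-verified Lean document; each statement's English description precedes it below -/
import Mathlib

section
/- Let f : ℝ → ℝ be continuously differentiable and let z̄ ∈ ℝ. Then F_z(t, z̄) = 0 for all t ∈ ℝ (i.e., z̄ is a fixed point of the flow generated by z' = F_z(t,z)) if and only if f(z̄) = 0 and f'(z̄) = 0. -/
open Filter Set

/-- The force `F_z(t,z) = −k F₀ f(z) sin(2kz − bt) + F₀ cos²(kz − bt/2) f'(z)`. -/
noncomputable def Fz (F₀ k b : ℝ) (f : ℝ → ℝ) (t z : ℝ) : ℝ :=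
  -k * F₀ * f z * Real.sin (2 * k * z - b * t)
    + F₀ * (Real.cos (k * z - b * t / 2)) ^ 2 * deriv f z

/-- `zbar` is a fixed point of the flow generated by `z' = F_z(t,z)` (i.e. `F_z(t,zbar) = 0`
for all `t`) if and only if `f(zbar) = 0` and `f'(zbar) = 0`. -/
theorem fixed_point_criterion (F₀ k b : ℝ) (hF₀ : 0 < F₀) (hk : 0 < k) (hb : 0 < b)
    (f : ℝ → ℝ) (hf : ContDiff ℝ 1 f) (zbar : ℝ) :
    (∀ t : ℝ, Fz F₀ k b f t zbar = 0) ↔ (f zbar = 0 ∧ deriv f zbar = 0) := by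
  constructor
  · intro h
    have hderiv : deriv f zbar = 0 := by
      have h0 := h (2 * k * zbar / b)
      have e₁ : 2 * k * zbar - b * (2 * k * zbar / b) = 0 := by field_simp; ring
      have e₂ : k * zbar - b * (2 * k * zbar / b) / 2 = 0 := by field_simp; ring
      simpa [Fz, e₁, e₂, hF₀.ne'] using h0
    have h1 := h ((2 * k * zbar - Real.pi / 2) / b)
    have e : 2 * k * zbar - b * ((2 * k * zbar - Real.pi / 2) / b) = Real.pi / 2 := by
      field_simp; ring
    refine ⟨?_, hderiv⟩
    simpa [Fz, e, hderiv, hF₀.ne', hk.ne'] using h1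
  · rintro ⟨h₀, h₁⟩ t
    simp [Fz, h₀, h₁]
end

section
/- Let f : ℝ → ℝ be continuously differentiable and let z : [0,T] → ℝ be a C¹ function satisfying z'(t) = F_z(t, z(t)) for all t ∈ [0,T] and z(0) = z(T). Then ∫₀ᵀ |z'(t)|² dt = ∫₀ᵀ |F_z(t, z(t))|² dt = −∫₀ᵀ (∂V/∂t)(t, z(t)) dt, where (∂V/∂t)(t,z) = (b/2) F₀ f(z) sin(2kz − bt). -/
open Filter Set intervalIntegral

/-- The potential `V(t,z) = F₀ f(z) cos²(kz − bt/2)`. -/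
noncomputable def potential (F₀ k b : ℝ) (f : ℝ → ℝ) (t z : ℝ) : ℝ :=
  F₀ * f z * (Real.cos (k * z - b * t / 2)) ^ 2

/-- Chain rule for the potential along a trajectory: `d/dt V(t, z(t)) = F_z z' + ∂V/∂t`. -/
theorem hasDerivAt_potential_comp (F₀ k b : ℝ) {f z : ℝ → ℝ} {t z' : ℝ}
    (hf : DifferentiableAt ℝ f (z t)) (hz : HasDerivAt z z' t) :
    HasDerivAt (fun s => potential F₀ k b f s (z s))
      (Fz F₀ k b f t (z t) * z'
        + b / 2 * F₀ * f (z t) * Real.sin (2 * k * z t - b * t)) t := by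
  have hphase : HasDerivAt (fun s => k * z s - b * s / 2) (k * z' - b * 1 / 2) t :=
    (hz.const_mul k).sub (((hasDerivAt_id t).const_mul b).div_const 2)
  have hfz : HasDerivAt (fun s => f (z s)) (deriv f (z t) * z') t :=
    hf.hasDerivAt.comp t hz
  have hsin : Real.sin (2 * k * z t - b * t)
      = 2 * Real.sin (k * z t - b * t / 2) * Real.cos (k * z t - b * t / 2) := by
    rw [← Real.sin_two_mul]
    congr 1
    ring
  refine ((hfz.const_mul F₀).mul (hphase.cos.pow 2)).congr_deriv ?_
  rw [Fz, hsin]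
  simp only [Pi.pow_apply]
  push_cast
  ring

theorem continuousOn_sin_phase (k b : ℝ) {z : ℝ → ℝ} {s : Set ℝ} (hz : ContinuousOn z s) :
    ContinuousOn (fun t => Real.sin (2 * k * z t - b * t)) s :=
  Real.continuous_sin.comp_continuousOn
    ((hz.const_mul (2 * k)).sub (continuousOn_id.const_mul b))

theorem continuousOn_cos_phase (k b : ℝ) {z : ℝ → ℝ} {s : Set ℝ} (hz : ContinuousOn z s) :
    ContinuousOn (fun t => Real.cos (k * z t - b * t / 2)) s :=
  Real.continuous_cos.comp_continuousOn
    ((hz.const_mul k).sub ((continuousOn_id.const_mul b).div_const 2))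

theorem continuousOn_Fz_comp (F₀ k b : ℝ) {f z : ℝ → ℝ} {s : Set ℝ}
    (hf : ContDiff ℝ 1 f) (hz : ContinuousOn z s) :
    ContinuousOn (fun t => Fz F₀ k b f t (z t)) s := by
  have hfz : ContinuousOn (fun t => f (z t)) s := hf.continuous.comp_continuousOn hz
  have hf'z : ContinuousOn (fun t => deriv f (z t)) s :=
    hf.continuous_deriv_one.comp_continuousOn hz
  exact ((hfz.const_mul (-k * F₀)).mul (continuousOn_sin_phase k b hz)).add
    ((((continuousOn_cos_phase k b hz).pow 2).const_mul F₀).mul hf'z)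

/-- For any `T`-periodic solution of `z' = F_z(t,z)` we have
`∫₀ᵀ |z'|² dt = ∫₀ᵀ |F_z(t,z(t))|² dt = −∫₀ᵀ (∂V/∂t)(t,z(t)) dt`, where
`(∂V/∂t)(t,z) = (b/2) F₀ f(z) sin(2kz − bt)`. -/
theorem energy_identity
    (F₀ k b : ℝ) (hF₀ : 0 < F₀) (hk : 0 < k) (hb : 0 < b)
    (T : ℝ) (hT : T = 4 * Real.pi / b)
    (f : ℝ → ℝ) (hf : ContDiff ℝ 1 f)
    (z : ℝ → ℝ)
    (hz : ∀ t ∈ Set.Icc 0 T, HasDerivWithinAt z (Fz F₀ k b f t (z t)) (Set.Icc 0 T) t)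
    (hper : z 0 = z T) :
    (∫ t in (0:ℝ)..T, |derivWithin z (Set.Icc 0 T) t| ^ 2)
        = (∫ t in (0:ℝ)..T, |Fz F₀ k b f t (z t)| ^ 2) ∧
    (∫ t in (0:ℝ)..T, |Fz F₀ k b f t (z t)| ^ 2)
        = -∫ t in (0:ℝ)..T, b / 2 * F₀ * f (z t) * Real.sin (2 * k * z t - b * t) := by
  have hT0 : 0 < T := by
    rw [hT]
    positivity
  have hzc : ContinuousOn z (Icc 0 T) := fun t ht => (hz t ht).continuousWithinAt
  have hfz : ContinuousOn (fun t => f (z t)) (Icc 0 T) :=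
    hf.continuous.comp_continuousOn hzc
  have hFc := continuousOn_Fz_comp F₀ k b hf hzc
  refine ⟨?_, ?_⟩
  · refine integral_congr fun t ht => ?_
    rw [uIcc_of_le hT0.le] at ht
    simp only [(hz t ht).derivWithin (uniqueDiffOn_Icc hT0 t ht)]
  · have hVc : ContinuousOn (fun t => potential F₀ k b f t (z t)) (Icc 0 T) :=
      (hfz.const_mul F₀).mul ((continuousOn_cos_phase k b hzc).pow 2)
    have hsq : IntervalIntegrable (fun t => |Fz F₀ k b f t (z t)| ^ 2)
        MeasureTheory.volume 0 T :=
      (hFc.abs.pow 2).intervalIntegrable_of_Icc hT0.le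
    have hVt : IntervalIntegrable
        (fun t => b / 2 * F₀ * f (z t) * Real.sin (2 * k * z t - b * t))
        MeasureTheory.volume 0 T :=
      ((hfz.const_mul (b / 2 * F₀)).mul
        (continuousOn_sin_phase k b hzc)).intervalIntegrable_of_Icc hT0.le
    have hderiv : ∀ t ∈ Ioo 0 T, HasDerivAt (fun t => potential F₀ k b f t (z t))
        (|Fz F₀ k b f t (z t)| ^ 2
          + b / 2 * F₀ * f (z t) * Real.sin (2 * k * z t - b * t)) t := by
      intro t ht
      have hzt := (hz t (Ioo_subset_Icc_self ht)).hasDerivAt (Icc_mem_nhds ht.1 ht.2)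
      rw [sq_abs, sq]
      exact hasDerivAt_potential_comp F₀ k b (hf.differentiable one_ne_zero _) hzt
    have hV : potential F₀ k b f T (z T) = potential F₀ k b f 0 (z 0) := by
      have hbT : b * T / 2 = 2 * Real.pi := by
        rw [hT]
        field_simp
        ring
      simp only [potential, hbT, hper, Real.cos_sub_two_pi, mul_zero, zero_div, sub_zero]
    have hFTC := integral_eq_sub_of_hasDerivAt_of_le hT0.le hVc hderiv (hsq.add hVt)
    rw [integral_add hsq hVt, hV, sub_self] at hFTC
    exact eq_neg_of_add_eq_zero_left hFTC
end

section
/- Let f : ℝ → ℝ be continuously differentiable and let z : [0,T] → ℝ be a C¹ function satisfying z'(t) = F_z(t, z(t)) for all t ∈ [0,T] and z(0) = z(T). Then ∫₀ᵀ |F_z(t, z(t))|² dt = −(b F₀ / (2k)) ∫₀ᵀ cos²(k z(t) − bt/2) f'(z(t)) dt. -/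
open Filter Set intervalIntegral

/-- For any `T`-periodic solution of `z' = F_z(t,z)` we have
`∫₀ᵀ |F_z(t,z(t))|² dt = −(b F₀/(2k)) ∫₀ᵀ cos²(kz(t) − bt/2) f'(z(t)) dt`. -/
theorem force_square_identity
    (F₀ k b : ℝ) (hF₀ : 0 < F₀) (hk : 0 < k) (hb : 0 < b)
    (T : ℝ) (hT : T = 4 * Real.pi / b)
    (f : ℝ → ℝ) (hf : ContDiff ℝ 1 f)
    (z : ℝ → ℝ)
    (hz : ∀ t ∈ Set.Icc 0 T, HasDerivWithinAt z (Fz F₀ k b f t (z t)) (Set.Icc 0 T) t)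
    (hper : z 0 = z T) :
    (∫ t in (0:ℝ)..T, |Fz F₀ k b f t (z t)| ^ 2)
      = -(b * F₀ / (2 * k)) *
          ∫ t in (0:ℝ)..T, (Real.cos (k * z t - b * t / 2)) ^ 2 * deriv f (z t) := by
  have hT0 : 0 ≤ T := by rw [hT]; positivity
  have hzc : ContinuousOn z (Set.Icc 0 T) := fun t ht => (hz t ht).continuousWithinAt
  have hfz : ContinuousOn (fun t => f (z t)) (Set.Icc 0 T) :=
    hf.continuous.comp_continuousOn hzc
  have hf'z : ContinuousOn (fun t => deriv f (z t)) (Set.Icc 0 T) :=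
    (hf.continuous_deriv le_rfl).comp_continuousOn hzc
  have hcos : ContinuousOn (fun t => Real.cos (k * z t - b * t / 2)) (Set.Icc 0 T) := by
    fun_prop
  have hsin : ContinuousOn (fun t => Real.sin (2 * k * z t - b * t)) (Set.Icc 0 T) := by
    fun_prop
  have hFc : ContinuousOn (fun t => |Fz F₀ k b f t (z t)| ^ 2) (Set.Icc 0 T) := by
    unfold Fz
    exact (((hfz.const_mul (-k * F₀)).mul hsin).add
      (((hcos.pow 2).const_mul F₀).mul hf'z)).abs.pow 2
  have hGc : ContinuousOn
      (fun t => (Real.cos (k * z t - b * t / 2)) ^ 2 * deriv f (z t)) (Set.Icc 0 T) :=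
    (hcos.pow 2).mul hf'z
  have hFi := hFc.intervalIntegrable_of_Icc (μ := MeasureTheory.volume) hT0
  have hGi := (hGc.intervalIntegrable_of_Icc (μ := MeasureTheory.volume) hT0).const_mul
    (b * F₀ / (2 * k))
  have key := integral_eq_sub_of_hasDerivAt_of_le
    (f := fun t => F₀ * (Real.cos (k * z t - b * t / 2)) ^ 2 * f (z t) + b / (2 * k) * z t)
    hT0 ((((hcos.pow 2).const_mul F₀).mul hfz).add (hzc.const_mul _)) (fun t ht => ?_) (hFi.add hGi)
  · have hcosT : Real.cos (k * z T - b * T / 2) = Real.cos (k * z T) := by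
      have h : b * T / 2 = 2 * Real.pi := by
        rw [hT]
        field_simp
        ring
      rw [h, Real.cos_sub_two_pi]
    simp only [hcosT, hper, mul_zero, zero_div, sub_zero, sub_self] at key
    rw [integral_add hFi hGi, integral_const_mul] at key
    linarith
  · have hzt := (hz t (Ioo_subset_Icc_self ht)).hasDerivAt (Icc_mem_nhds ht.1 ht.2)
    have hft : HasDerivAt (fun s => f (z s)) _ t :=
      ((hf.differentiable one_ne_zero (z t)).hasDerivAt).comp t hzt
    have hphase := (hzt.const_mul k).sub (((hasDerivAt_id t).const_mul b).div_const 2)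
    have hderiv := ((((hphase.cos).pow 2).const_mul F₀).mul hft).add (hzt.const_mul (b / (2 * k)))
    refine hderiv.congr_deriv ?_
    have hdouble : Real.sin (2 * k * z t - b * t) =
        2 * Real.sin (k * z t - b * t / 2) * Real.cos (k * z t - b * t / 2) := by
      rw [← Real.sin_two_mul]
      congr 1
      ring
    simp only [Pi.sub_apply, Pi.pow_apply, id, sq_abs, Fz, hdouble]
    field_simp
    ring
end

section
/- Let f(z) = z₀²/(z₀² + z²) with z₀ > 0. There exists ρ > 0 such that for every λ ∈ (0,1) and every C¹ function z_λ : [0,T] → ℝ satisfying z_λ'(t) = −(1−λ) z_λ(t) + λ F_z(t, z_λ(t)) for all t ∈ [0,T] and z_λ(0) = z_λ(T), one has max_{t ∈ [0,T]} |z_λ(t)| ≤ ρ. -/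
open Filter Set

section Lorentzian

variable {z₀ : ℝ}

/-- The Lorentzian profile `z₀² / (z₀² + z²)`. -/
noncomputable def lorentzian (z₀ z : ℝ) : ℝ := z₀ ^ 2 / (z₀ ^ 2 + z ^ 2)

/-- The first derivative of the Lorentzian profile. -/
noncomputable def lorentzianDeriv (z₀ z : ℝ) : ℝ := -2 * z / z₀ ^ 2 * lorentzian z₀ z ^ 2

/-- The second derivative of the Lorentzian profile. -/
noncomputable def lorentzianDeriv₂ (z₀ z : ℝ) : ℝ :=
  z₀ ^ 2 * (6 * z ^ 2 - 2 * z₀ ^ 2) / (z₀ ^ 2 + z ^ 2) ^ 3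

lemma lorentzian_pos (hz₀ : 0 < z₀) (z : ℝ) : 0 < lorentzian z₀ z := by
  unfold lorentzian; positivity

lemma hasDerivAt_lorentzian (hz₀ : 0 < z₀) (z : ℝ) :
    HasDerivAt (lorentzian z₀) (lorentzianDeriv z₀ z) z := by
  have hne : z₀ ^ 2 + z ^ 2 ≠ 0 := by positivity
  have h := (hasDerivAt_const z (z₀ ^ 2)).div (((hasDerivAt_id z).pow 2).const_add (z₀ ^ 2)) hne
  refine h.congr_deriv ?_
  simp only [lorentzianDeriv, lorentzian, id, Pi.pow_apply]
  field_simp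
  norm_num
  ring

lemma hasDerivAt_lorentzianDeriv (hz₀ : 0 < z₀) (z : ℝ) :
    HasDerivAt (lorentzianDeriv z₀) (lorentzianDeriv₂ z₀ z) z := by
  have hne : z₀ ^ 2 + z ^ 2 ≠ 0 := by positivity
  have h := (((hasDerivAt_id z).const_mul (-2)).div_const (z₀ ^ 2)).mul
    ((hasDerivAt_lorentzian hz₀ z).pow 2)
  refine h.congr_deriv ?_
  simp only [lorentzianDeriv₂, lorentzianDeriv, lorentzian, id, Pi.pow_apply]
  have hne' : z₀ ≠ 0 := hz₀.ne'
  push_cast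
  field_simp
  ring

lemma abs_mul_lorentzian_le (hz₀ : 0 < z₀) (z : ℝ) : |z| * lorentzian z₀ z ≤ z₀ := by
  rw [lorentzian, mul_div_assoc', div_le_iff₀ (by positivity), ← sq_abs z]
  nlinarith [sq_nonneg (|z| - z₀), mul_nonneg hz₀.le (sq_nonneg (|z| - z₀)), pow_pos hz₀ 3,
    mul_pos hz₀ hz₀]

lemma abs_lorentzianDeriv_le (hz₀ : 0 < z₀) (z : ℝ) :
    |lorentzianDeriv z₀ z| ≤ lorentzian z₀ z / z₀ := by
  have hpos : 0 < z₀ ^ 2 + z ^ 2 := by positivity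
  have hF := lorentzian_pos hz₀ z
  have h : 2 * |z| * lorentzian z₀ z ≤ z₀ := by
    rw [lorentzian, mul_div_assoc', div_le_iff₀ hpos, ← sq_abs z]
    nlinarith [mul_nonneg hz₀.le (sq_nonneg (|z| - z₀))]
  rw [lorentzianDeriv, abs_mul, abs_div, abs_mul, abs_of_pos (pow_pos hF 2),
    abs_of_pos (pow_pos hz₀ 2), show |(-2 : ℝ)| = 2 by norm_num]
  calc 2 * |z| / z₀ ^ 2 * lorentzian z₀ z ^ 2
      = 2 * |z| * lorentzian z₀ z * (lorentzian z₀ z / z₀ ^ 2) := by ring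
    _ ≤ z₀ * (lorentzian z₀ z / z₀ ^ 2) := by gcongr
    _ = lorentzian z₀ z / z₀ := by field_simp

lemma abs_lorentzianDeriv₂_le (hz₀ : 0 < z₀) (z : ℝ) :
    |lorentzianDeriv₂ z₀ z| ≤ 6 / z₀ ^ 2 * lorentzian z₀ z := by
  have hpos : 0 < z₀ ^ 2 + z ^ 2 := by positivity
  have hnum : |6 * z ^ 2 - 2 * z₀ ^ 2| ≤ 6 * (z₀ ^ 2 + z ^ 2) :=
    abs_le.2 ⟨by nlinarith [sq_nonneg z, sq_nonneg z₀], by nlinarith [sq_nonneg z, sq_nonneg z₀]⟩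
  rw [lorentzianDeriv₂, abs_div, abs_mul, abs_of_pos (pow_pos hpos 3),
    abs_of_pos (pow_pos hz₀ 2), div_le_iff₀ (pow_pos hpos 3)]
  calc z₀ ^ 2 * |6 * z ^ 2 - 2 * z₀ ^ 2| ≤ z₀ ^ 2 * (6 * (z₀ ^ 2 + z ^ 2)) := by gcongr
    _ = 6 * (z₀ ^ 2 + z ^ 2) * z₀ ^ 2 := by ring
    _ ≤ 6 * (z₀ ^ 2 + z ^ 2) * (z₀ ^ 2 + z ^ 2) := by
        gcongr; nlinarith [sq_nonneg z]
    _ ≤ 6 / z₀ ^ 2 * lorentzian z₀ z * (z₀ ^ 2 + z ^ 2) ^ 3 := by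
        rw [lorentzian]; field_simp; rfl

end Lorentzian

/-- The remainder produced when the oscillating terms of `Fz` are averaged out. -/
noncomputable def averagingRemainder (F₀ k b z₀ t z : ℝ) : ℝ :=
  k * F₀ / b * (lorentzianDeriv z₀ z * Real.cos (2 * k * z - b * t)
      - 2 * k * lorentzian z₀ z * Real.sin (2 * k * z - b * t))
    + F₀ / (2 * b) * (lorentzianDeriv₂ z₀ z * Real.sin (2 * k * z - b * t)
      + 2 * k * lorentzianDeriv z₀ z * Real.cos (2 * k * z - b * t))

lemma abs_mul_le_of_abs_le_one {x y a : ℝ} (hx : |x| ≤ a) (hy : |y| ≤ 1) : |x * y| ≤ a := by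
  rw [abs_mul]
  exact (mul_le_of_le_one_right (abs_nonneg x) hy).trans hx

section Bounds

variable {F₀ k b z₀ : ℝ}

lemma Fz_lorentzian (hz₀ : 0 < z₀) (t z : ℝ) :
    Fz F₀ k b (lorentzian z₀) t z =
      -k * F₀ * lorentzian z₀ z * Real.sin (2 * k * z - b * t)
        + F₀ / 2 * lorentzianDeriv z₀ z * (1 + Real.cos (2 * k * z - b * t)) := by
  rw [Fz, (hasDerivAt_lorentzian hz₀ z).deriv, Real.cos_sq,
    show 2 * (k * z - b * t / 2) = 2 * k * z - b * t by ring]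
  ring

lemma abs_Fz_lorentzian_le (hF₀ : 0 < F₀) (hk : 0 < k) (hz₀ : 0 < z₀) (t z : ℝ) :
    |Fz F₀ k b (lorentzian z₀) t z| ≤ (k * F₀ + F₀ / z₀) * lorentzian z₀ z := by
  have hF := lorentzian_pos hz₀ z
  have hD := abs_lorentzianDeriv_le hz₀ z
  have hc : |(Real.cos (k * z - b * t / 2)) ^ 2| ≤ 1 := by
    rw [abs_of_nonneg (sq_nonneg _)]; exact Real.cos_sq_le_one _
  have h₁ : |k * F₀ * lorentzian z₀ z * Real.sin (2 * k * z - b * t)|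
      ≤ k * F₀ * lorentzian z₀ z :=
    abs_mul_le_of_abs_le_one (abs_of_pos (by positivity)).le (Real.abs_sin_le_one _)
  have h₂ : |lorentzianDeriv z₀ z * (Real.cos (k * z - b * t / 2)) ^ 2| ≤ lorentzian z₀ z / z₀ :=
    abs_mul_le_of_abs_le_one hD hc
  have h₃ := mul_le_mul_of_nonneg_left (abs_le.1 h₂).1 hF₀.le
  have h₄ := mul_le_mul_of_nonneg_left (abs_le.1 h₂).2 hF₀.le
  rw [abs_le] at h₁
  have e : (k * F₀ + F₀ / z₀) * lorentzian z₀ z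
      = k * F₀ * lorentzian z₀ z + F₀ * (lorentzian z₀ z / z₀) := by ring
  rw [Fz, (hasDerivAt_lorentzian hz₀ z).deriv, e, abs_le]
  constructor <;> linarith

lemma abs_averagingRemainder_le (hF₀ : 0 < F₀) (hk : 0 < k) (hb : 0 < b) (hz₀ : 0 < z₀)
    (t z : ℝ) :
    |averagingRemainder F₀ k b z₀ t z| ≤
      (k * F₀ / b * (1 / z₀ + 2 * k) + F₀ / (2 * b) * (6 / z₀ ^ 2 + 2 * k / z₀))
        * lorentzian z₀ z := by
  have hF := lorentzian_pos hz₀ z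
  have hs := Real.abs_sin_le_one (2 * k * z - b * t)
  have hc := Real.abs_cos_le_one (2 * k * z - b * t)
  have h₁ := abs_mul_le_of_abs_le_one (abs_lorentzianDeriv_le hz₀ z) hc
  have h₂ := abs_mul_le_of_abs_le_one (abs_of_pos hF).le hs
  have h₃ := abs_mul_le_of_abs_le_one (abs_lorentzianDeriv₂_le hz₀ z) hs
  rw [abs_le] at h₁ h₂ h₃
  have p₁ : 0 < k * F₀ / b := by positivity
  have p₂ : 0 < k * F₀ / b * (2 * k) := by positivity
  have p₃ : 0 < F₀ / (2 * b) := by positivity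
  have p₄ : 0 < F₀ / (2 * b) * (2 * k) := by positivity
  have e : (k * F₀ / b * (1 / z₀ + 2 * k) + F₀ / (2 * b) * (6 / z₀ ^ 2 + 2 * k / z₀))
      * lorentzian z₀ z = k * F₀ / b * (lorentzian z₀ z / z₀)
        + k * F₀ / b * (2 * k) * lorentzian z₀ z
        + F₀ / (2 * b) * (6 / z₀ ^ 2 * lorentzian z₀ z)
        + F₀ / (2 * b) * (2 * k) * (lorentzian z₀ z / z₀) := by ring
  rw [e, averagingRemainder, abs_le]
  constructor
  · linarith [mul_le_mul_of_nonneg_left h₁.1 p₁.le, mul_le_mul_of_nonneg_left h₂.2 p₂.le,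
      mul_le_mul_of_nonneg_left h₃.1 p₃.le, mul_le_mul_of_nonneg_left h₁.1 p₄.le]
  · linarith [mul_le_mul_of_nonneg_left h₁.2 p₁.le, mul_le_mul_of_nonneg_left h₂.1 p₂.le,
      mul_le_mul_of_nonneg_left h₃.2 p₃.le, mul_le_mul_of_nonneg_left h₁.2 p₄.le]

end Bounds

/-- The near-identity change of variables which averages out the oscillating terms of `Fz`. -/
noncomputable def averagedCoordinate (F₀ k b z₀ lam t z : ℝ) : ℝ :=
  z + lam * (k * F₀ / b * (lorentzian z₀ z * Real.cos (2 * k * z - b * t))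
    + F₀ / (2 * b) * (lorentzianDeriv z₀ z * Real.sin (2 * k * z - b * t)))

section Solutions

variable {F₀ k b z₀ lam : ℝ} {z : ℝ → ℝ}

lemma HasDerivAt.averagedCoordinate (hb : 0 < b) (hz₀ : 0 < z₀) {t : ℝ}
    (h : HasDerivAt z (-(1 - lam) * z t + lam * Fz F₀ k b (lorentzian z₀) t (z t)) t) :
    HasDerivAt (fun s => averagedCoordinate F₀ k b z₀ lam s (z s))
      (-(1 - lam) * z t * (1 + lam * averagingRemainder F₀ k b z₀ t (z t))
        + lam * (F₀ / 2 * lorentzianDeriv z₀ (z t))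
        + lam ^ 2 * (Fz F₀ k b (lorentzian z₀) t (z t)
          * averagingRemainder F₀ k b z₀ t (z t))) t := by
  have hθ := (h.const_mul (2 * k)).sub ((hasDerivAt_id t).const_mul b)
  have h₁ := ((hasDerivAt_lorentzian hz₀ (z t)).comp t h).mul hθ.cos
  have h₂ := ((hasDerivAt_lorentzianDeriv hz₀ (z t)).comp t h).mul hθ.sin
  have h₃ := h.add (((h₁.const_mul (k * F₀ / b)).add (h₂.const_mul (F₀ / (2 * b)))).const_mul lam)
  refine h₃.congr_deriv ?_
  simp only [averagingRemainder, Function.comp, id, Pi.sub_apply, Fz_lorentzian hz₀]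
  field_simp
  ring

lemma averagedCoordinate_deriv_mul_neg (hF₀ : 0 < F₀) (hz₀ : 0 < z₀) (hlam : lam ∈ Ioo (0 : ℝ) 1)
    {x F E K C : ℝ} (hK : 0 < K) (hC : 0 < C) (hF : |F| ≤ K * lorentzian z₀ x)
    (hE : |E| ≤ C * lorentzian z₀ x) (hx : C * z₀ + K * C * z₀ ^ 2 / F₀ < |x|) :
    x * (-(1 - lam) * x * (1 + lam * E) + lam * (F₀ / 2 * lorentzianDeriv z₀ x)
      + lam ^ 2 * (F * E)) < 0 := by
  obtain ⟨hl₀, hl₁⟩ := hlam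
  have hL := lorentzian_pos hz₀ x
  have hxC : C * z₀ < |x| := lt_of_le_of_lt (le_add_of_nonneg_right (by positivity)) hx
  have hxK : K * C < F₀ * |x| / z₀ ^ 2 := by
    have : K * C * z₀ ^ 2 / F₀ < |x| := lt_of_le_of_lt (le_add_of_nonneg_left (by positivity)) hx
    rw [lt_div_iff₀ (by positivity)]
    rwa [div_lt_iff₀' hF₀] at this
  have hx₀ : 0 < |x| := lt_trans (by positivity) hxC
  have hE₁ : |E| ≤ 1 := by
    have h := mul_le_mul_of_nonneg_left (abs_mul_lorentzian_le hz₀ x) hC.le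
    have h' : |x| * (C * lorentzian z₀ x) ≤ |x| * 1 := by linarith
    exact hE.trans (le_of_mul_le_mul_left h' hx₀)
  have hdamp : 0 ≤ (1 - lam) * x ^ 2 * (1 + lam * E) := by
    have : 0 ≤ 1 + lam * E := by nlinarith [(abs_le.1 hE₁).1]
    have : 0 ≤ 1 - lam := by linarith
    positivity
  have hFE : |x * (F * E)| ≤ |x| * (K * C * lorentzian z₀ x ^ 2) := by
    rw [abs_mul, abs_mul]
    calc |x| * (|F| * |E|) ≤ |x| * ((K * lorentzian z₀ x) * (C * lorentzian z₀ x)) := by gcongr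
      _ = _ := by ring
  have hmain : x * (F₀ / 2 * lorentzianDeriv z₀ x)
      = -(|x| * (F₀ * |x| / z₀ ^ 2 * lorentzian z₀ x ^ 2)) := by
    rw [lorentzianDeriv]
    linear_combination (F₀ / z₀ ^ 2 * lorentzian z₀ x ^ 2) * sq_abs x
  have hlt : |x| * (K * C * lorentzian z₀ x ^ 2)
      < |x| * (F₀ * |x| / z₀ ^ 2 * lorentzian z₀ x ^ 2) := by gcongr
  have hsum : x * (F₀ / 2 * lorentzianDeriv z₀ x) + lam * (x * (F * E)) < 0 := by
    have : lam * (x * (F * E)) ≤ |x * (F * E)| :=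
      (mul_le_mul_of_nonneg_left (le_abs_self _) hl₀.le).trans
        (mul_le_of_le_one_left (abs_nonneg _) hl₁.le)
    linarith
  nlinarith [mul_neg_of_pos_of_neg hl₀ hsum]

/-- If `z z'` is bounded above along a closed trajectory, then `z²` has bounded oscillation. -/
lemma sq_le_sq_add_of_closed {z' : ℝ → ℝ} {T B : ℝ} (hB : 0 ≤ B)
    (hz : ∀ t ∈ Icc 0 T, HasDerivWithinAt z (z' t) (Icc 0 T) t)
    (hzB : ∀ t ∈ Icc 0 T, z t * z' t ≤ B) (hper : z 0 = z T)
    {s t : ℝ} (hs : s ∈ Icc 0 T) (ht : t ∈ Icc 0 T) : z s ^ 2 ≤ z t ^ 2 + 4 * B * T := by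
  have hT : 0 ≤ T := hs.1.trans hs.2
  have hanti : AntitoneOn (fun r => z r ^ 2 - 2 * B * r) (Icc 0 T) := by
    have hd : ∀ r ∈ Icc 0 T, HasDerivWithinAt (fun r => z r ^ 2 - 2 * B * r)
        (2 * z r * z' r - 2 * B) (Icc 0 T) r := fun r hr =>
      (((hz r hr).pow 2).sub ((hasDerivWithinAt_id r _).const_mul (2 * B))).congr_deriv (by simp)
    refine antitoneOn_of_hasDerivWithinAt_nonpos (convex_Icc 0 T)
      (fun r hr => (hd r hr).continuousWithinAt)
      (fun r hr => (hd r (interior_subset hr)).mono interior_subset) fun r hr => ?_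
    linarith [hzB r (interior_subset hr)]
  have h₁ := hanti (left_mem_Icc.2 hT) hs hs.1
  have h₂ := hanti ht (right_mem_Icc.2 hT) ht.2
  simp only [hper] at h₁ h₂
  nlinarith [mul_le_mul_of_nonneg_left hs.2 hB, mul_nonneg hB ht.1]

end Solutions

/-- Uniform a priori bound for the homotopy problem
`z' = −(1−λ)z + λ F_z(t,z)`, `z(0) = z(T)`, `λ ∈ (0,1)`, in the Lorentzian case
`f(z) = z₀²/(z₀² + z²)`. -/
theorem homotopy_bound_lorentzian
    (F₀ k b z₀ : ℝ) (hF₀ : 0 < F₀) (hk : 0 < k) (hb : 0 < b) (hz₀ : 0 < z₀)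
    (T : ℝ) (hT : T = 4 * Real.pi / b)
    (f : ℝ → ℝ) (hf : f = fun w => z₀ ^ 2 / (z₀ ^ 2 + w ^ 2)) :
    ∃ ρ > 0, ∀ lam : ℝ, lam ∈ Set.Ioo (0:ℝ) 1 → ∀ z : ℝ → ℝ,
      (∀ t ∈ Set.Icc 0 T,
        HasDerivWithinAt z (-(1 - lam) * z t + lam * Fz F₀ k b f t (z t)) (Set.Icc 0 T) t) →
      z 0 = z T →
      ∀ t ∈ Set.Icc 0 T, |z t| ≤ ρ := by
  obtain rfl : f = lorentzian z₀ := hf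
  have hTpos : 0 < T := by rw [hT]; positivity
  obtain ⟨K, hKpos, hFb⟩ :
      ∃ K > 0, ∀ t x, |Fz F₀ k b (lorentzian z₀) t x| ≤ K * lorentzian z₀ x :=
    ⟨_, by positivity, abs_Fz_lorentzian_le hF₀ hk hz₀⟩
  obtain ⟨C, hCpos, hEb⟩ :
      ∃ C > 0, ∀ t x, |averagingRemainder F₀ k b z₀ t x| ≤ C * lorentzian z₀ x :=
    ⟨_, by positivity, abs_averagingRemainder_le hF₀ hk hb hz₀⟩
  obtain ⟨R, hR⟩ : ∃ R, R = C * z₀ + K * C * z₀ ^ 2 / F₀ := ⟨_, rfl⟩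
  obtain ⟨B, hB⟩ : ∃ B, B = K * z₀ := ⟨_, rfl⟩
  have hBpos : 0 < B := by rw [hB]; positivity
  refine ⟨R ^ 2 + 4 * B * T + 1, by positivity, fun lam hlam z hz hper s hs => ?_⟩
  have hzB : ∀ t ∈ Icc 0 T,
      z t * (-(1 - lam) * z t + lam * Fz F₀ k b (lorentzian z₀) t (z t)) ≤ B := by
    intro t _
    have h₁ : |z t * Fz F₀ k b (lorentzian z₀) t (z t)| ≤ B := by
      rw [abs_mul]
      calc |z t| * |Fz F₀ k b (lorentzian z₀) t (z t)|
          ≤ |z t| * (K * lorentzian z₀ (z t)) := by gcongr; exact hFb t (z t)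
        _ = K * (|z t| * lorentzian z₀ (z t)) := by ring
        _ ≤ B := by rw [hB]; gcongr; exact abs_mul_lorentzian_le hz₀ _
    have h₂ : lam * (z t * Fz F₀ k b (lorentzian z₀) t (z t)) ≤ B :=
      ((mul_le_mul_of_nonneg_left (le_abs_self _) hlam.1.le).trans
        (mul_le_of_le_one_left (abs_nonneg _) hlam.2.le)).trans h₁
    nlinarith [mul_nonneg (sub_nonneg.2 hlam.2.le) (sq_nonneg (z t))]
  have hzc : ContinuousOn z (Icc 0 T) := fun t ht => (hz t ht).continuousWithinAt
  have hLc : Continuous (lorentzian z₀) :=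
    continuous_iff_continuousAt.2 fun x => (hasDerivAt_lorentzian hz₀ x).continuousAt
  have hDc : Continuous (lorentzianDeriv z₀) :=
    continuous_iff_continuousAt.2 fun x => (hasDerivAt_lorentzianDeriv hz₀ x).continuousAt
  have hΦc : ContinuousOn (fun t => averagedCoordinate F₀ k b z₀ lam t (z t)) (Icc 0 T) := by
    simp only [averagedCoordinate]
    fun_prop
  have hΦper : averagedCoordinate F₀ k b z₀ lam 0 (z 0)
      = averagedCoordinate F₀ k b z₀ lam T (z T) := by
    have hθ : 2 * k * z T - b * T = 2 * k * z T - b * 0 - (2 : ℕ) * (2 * Real.pi) := by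
      rw [hT]; field_simp; push_cast; ring
    simp only [averagedCoordinate, hper]
    rw [hθ, Real.cos_sub_nat_mul_two_pi, Real.sin_sub_nat_mul_two_pi]
  obtain ⟨c, hc, hc₀⟩ := exists_hasDerivAt_eq_zero hTpos hΦc hΦper fun t ht =>
    ((hz t (Ioo_subset_Icc_self ht)).hasDerivAt (Icc_mem_nhds ht.1 ht.2)).averagedCoordinate
      hb hz₀
  have hcR : |z c| ≤ R := by
    by_contra! hlt
    have hneg := averagedCoordinate_deriv_mul_neg hF₀ hz₀ hlam hKpos hCpos (hFb c (z c))
      (hEb c (z c)) (hR ▸ hlt)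
    rw [hc₀, mul_zero] at hneg
    exact lt_irrefl 0 hneg
  have hsq := sq_le_sq_add_of_closed hBpos.le hz hzB hper hs (Ioo_subset_Icc_self hc)
  have hcsq : z c ^ 2 ≤ R ^ 2 := sq_le_sq.2 (hcR.trans (le_abs_self R))
  refine abs_le_of_sq_le_sq ?_ (by positivity)
  nlinarith [sq_nonneg (R ^ 2 + 4 * B * T), show 0 ≤ R ^ 2 + 4 * B * T by positivity]
end

section
/- Let f(z) = z₀²/(z₀² + z²) with z₀ > 0. There exists a constant D > 0 such that every C¹ function z : [0,T] → ℝ satisfying z'(t) = F_z(t, z(t)) for all t ∈ [0,T] and z(0) = z(T) satisfies max_{t ∈ [0,T]} |z(t)| ≤ D. -/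
open Filter Set

section Lorentzian

variable {z₀ : ℝ}

/-- Derivative of the Lorentzian, expressed in terms of the Lorentzian itself. -/
lemma hasDerivAt_lorentzian_s7 (hz₀ : 0 < z₀) (x : ℝ) :
    HasDerivAt (fun w => z₀ ^ 2 / (z₀ ^ 2 + w ^ 2))
      (-2 * x * (z₀ ^ 2 / (z₀ ^ 2 + x ^ 2)) ^ 2 / z₀ ^ 2) x := by
  have hne : z₀ ^ 2 + x ^ 2 ≠ 0 := by positivity
  have h := (hasDerivAt_const x (z₀ ^ 2)).div (((hasDerivAt_id x).pow 2).const_add (z₀ ^ 2)) hne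
  refine h.congr_deriv ?_
  simp only [id, Pi.pow_apply]
  field_simp
  ring

lemma hasDerivAt_deriv_lorentzian (hz₀ : 0 < z₀) (x : ℝ) :
    HasDerivAt (fun w => -2 * w * (z₀ ^ 2 / (z₀ ^ 2 + w ^ 2)) ^ 2 / z₀ ^ 2)
      (-2 * (z₀ ^ 2 / (z₀ ^ 2 + x ^ 2)) ^ 2 / z₀ ^ 2
        + 8 * x ^ 2 * (z₀ ^ 2 / (z₀ ^ 2 + x ^ 2)) ^ 3 / z₀ ^ 4) x := by
  have h := ((((hasDerivAt_id x).const_mul (-2)).mul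
    ((hasDerivAt_lorentzian_s7 hz₀ x).pow 2)).div_const (z₀ ^ 2))
  refine h.congr_deriv ?_
  simp only [id, Pi.pow_apply, Nat.reduceSub, pow_one]
  field_simp
  ring

lemma lorentzian_pos_s7 (hz₀ : 0 < z₀) (x : ℝ) : 0 < z₀ ^ 2 / (z₀ ^ 2 + x ^ 2) := by
  positivity

lemma lorentzian_le_one (hz₀ : 0 < z₀) (x : ℝ) : z₀ ^ 2 / (z₀ ^ 2 + x ^ 2) ≤ 1 := by
  rw [div_le_one (by positivity)]
  nlinarith [sq_nonneg x]

lemma abs_deriv_lorentzian_le (hz₀ : 0 < z₀) (x : ℝ) :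
    |-2 * x * (z₀ ^ 2 / (z₀ ^ 2 + x ^ 2)) ^ 2 / z₀ ^ 2|
      ≤ z₀ ^ 2 / (z₀ ^ 2 + x ^ 2) * (1 / z₀) := by
  have hp := lorentzian_pos_s7 hz₀ x
  have e : -2 * x * (z₀ ^ 2 / (z₀ ^ 2 + x ^ 2)) ^ 2 / z₀ ^ 2
      = z₀ ^ 2 / (z₀ ^ 2 + x ^ 2) * (-2 * x / (z₀ ^ 2 + x ^ 2)) := by
    field_simp
  rw [e, abs_mul, abs_of_pos hp]
  refine mul_le_mul_of_nonneg_left ?_ hp.le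
  rw [abs_div, abs_of_pos (show 0 < z₀ ^ 2 + x ^ 2 by positivity), abs_mul, abs_neg, abs_two,
    div_le_div_iff₀ (by positivity) hz₀]
  nlinarith [sq_nonneg (|x| - z₀), sq_abs x]

lemma abs_deriv_deriv_lorentzian_le (hz₀ : 0 < z₀) (x : ℝ) :
    |-2 * (z₀ ^ 2 / (z₀ ^ 2 + x ^ 2)) ^ 2 / z₀ ^ 2
        + 8 * x ^ 2 * (z₀ ^ 2 / (z₀ ^ 2 + x ^ 2)) ^ 3 / z₀ ^ 4|
      ≤ z₀ ^ 2 / (z₀ ^ 2 + x ^ 2) * (10 / z₀ ^ 2) := by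
  have hp := lorentzian_pos_s7 hz₀ x
  have h1 := lorentzian_le_one hz₀ x
  have hx : x ^ 2 * (z₀ ^ 2 / (z₀ ^ 2 + x ^ 2)) = z₀ ^ 2 * (1 - z₀ ^ 2 / (z₀ ^ 2 + x ^ 2)) := by
    field_simp
    ring
  set p := z₀ ^ 2 / (z₀ ^ 2 + x ^ 2)
  have e : -2 * p ^ 2 / z₀ ^ 2 + 8 * x ^ 2 * p ^ 3 / z₀ ^ 4
      = p * ((-2 * p + 8 * (1 - p) * p) / z₀ ^ 2) := by
    have : 8 * x ^ 2 * p ^ 3 / z₀ ^ 4 = 8 * (x ^ 2 * p) * p ^ 2 / z₀ ^ 4 := by ring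
    rw [this, hx]
    field_simp
  rw [e, abs_mul, abs_of_pos hp, abs_div, abs_of_pos (show 0 < z₀ ^ 2 by positivity)]
  refine mul_le_mul_of_nonneg_left ?_ hp.le
  gcongr
  rw [abs_le]
  constructor <;> nlinarith

end Lorentzian

lemma Fz_eq (F₀ k b : ℝ) (f : ℝ → ℝ) (t z : ℝ) :
    Fz F₀ k b f t z = -k * F₀ * f z * Real.sin (2 * k * z - b * t)
      + F₀ / 2 * (1 + Real.cos (2 * k * z - b * t)) * deriv f z := by
  rw [Fz, Real.cos_sq, show 2 * (k * z - b * t / 2) = 2 * k * z - b * t by ring]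
  ring

lemma abs_Fz_le {F₀ k b A : ℝ} {f : ℝ → ℝ} (hF₀ : 0 ≤ F₀) (hk : 0 ≤ k) (t : ℝ) {z : ℝ}
    (hf : 0 ≤ f z) (hf' : |deriv f z| ≤ f z * A) :
    |Fz F₀ k b f t z| ≤ f z * (k * F₀ + F₀ * A) := by
  rw [Fz]
  refine (abs_add_le _ _).trans ?_
  have h1 : |-k * F₀ * f z * Real.sin (2 * k * z - b * t)| ≤ k * F₀ * f z := by
    rw [abs_mul, show |-k * F₀ * f z| = k * F₀ * f z by
      rw [neg_mul, neg_mul, abs_neg, abs_of_nonneg (by positivity)]]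
    exact mul_le_of_le_one_right (by positivity) (Real.abs_sin_le_one _)
  have h2 : |F₀ * Real.cos (k * z - b * t / 2) ^ 2 * deriv f z| ≤ F₀ * (f z * A) := by
    rw [abs_mul, abs_of_nonneg (by positivity)]
    exact mul_le_mul (mul_le_of_le_one_right hF₀ (Real.cos_sq_le_one _)) hf' (abs_nonneg _) hF₀
  linarith

/-- Subtracting the oscillating part of the force from `z` leaves a quantity whose derivative is
the averaged drift `F₀ f'(z) / 2` plus a remainder proportional to `z'`. -/
lemma hasDerivAt_near_identity {F₀ k b t v p' p'' : ℝ} {f f' z : ℝ → ℝ} (hb : b ≠ 0)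
    (hz : HasDerivAt z v t) (hf : HasDerivAt f p' (z t)) (hf' : HasDerivAt f' p'' (z t))
    (hp' : f' (z t) = p') (hv : v = Fz F₀ k b f t (z t)) :
    HasDerivAt (fun s => z s + k * F₀ / b * (f (z s) * Real.cos (2 * k * z s - b * s))
        + F₀ / (2 * b) * (f' (z s) * Real.sin (2 * k * z s - b * s)))
      (F₀ / 2 * p' + v * (k * F₀ / b * (p' * Real.cos (2 * k * z t - b * t)
          - 2 * k * f (z t) * Real.sin (2 * k * z t - b * t))
        + F₀ / (2 * b) * (p'' * Real.sin (2 * k * z t - b * t)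
          + 2 * k * p' * Real.cos (2 * k * z t - b * t)))) t := by
  have hθ : HasDerivAt (fun s => 2 * k * z s - b * s) (2 * k * v - b * 1) t :=
    (hz.const_mul (2 * k)).sub ((hasDerivAt_id t).const_mul b)
  have h := (hz.add (((hf.comp t hz).mul hθ.cos).const_mul (k * F₀ / b))).add
    (((hf'.comp t hz).mul hθ.sin).const_mul (F₀ / (2 * b)))
  refine h.congr_deriv ?_
  rw [Fz_eq, hf.deriv] at hv
  simp only [Function.comp, hp']
  generalize Real.sin (2 * k * z t - b * t) = s at *
  generalize Real.cos (2 * k * z t - b * t) = c at *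
  field_simp
  linear_combination 2 * b * hv

lemma abs_mul_add_mul_le {x y s c X Y : ℝ} (hx : |x| ≤ X) (hy : |y| ≤ Y) (hs : |s| ≤ 1)
    (hc : |c| ≤ 1) : |x * s + y * c| ≤ X + Y := by
  refine (abs_add_le _ _).trans ?_
  rw [abs_mul, abs_mul]
  exact add_le_add ((mul_le_of_le_one_right (abs_nonneg _) hs).trans hx)
    ((mul_le_of_le_one_right (abs_nonneg _) hc).trans hy)

/-- The remainder is quadratic in the Lorentzian. -/
lemma abs_remainder_le {F₀ k b v p p' p'' s c K A B : ℝ} (hF₀ : 0 < F₀) (hk : 0 < k) (hb : 0 < b)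
    (hp : 0 ≤ p) (hv : |v| ≤ p * K) (hp' : |p'| ≤ p * A) (hp'' : |p''| ≤ p * B)
    (hs : |s| ≤ 1) (hc : |c| ≤ 1) :
    |v * (k * F₀ / b * (p' * c - 2 * k * p * s) + F₀ / (2 * b) * (p'' * s + 2 * k * p' * c))|
      ≤ p ^ 2 * (K * (k * F₀ / b * (A + 2 * k) + F₀ / (2 * b) * (B + 2 * k * A))) := by
  have h1 : |p' * c + -(2 * k * p) * s| ≤ p * A + 2 * k * p :=
    abs_mul_add_mul_le hp' (by rw [abs_neg, abs_of_nonneg (by positivity)]) hc hs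
  have h2 : |p'' * s + 2 * k * p' * c| ≤ p * B + 2 * k * (p * A) :=
    abs_mul_add_mul_le hp'' (by rw [abs_mul, abs_of_pos (by positivity : 0 < 2 * k)]; gcongr) hs hc
  rw [show p' * c + -(2 * k * p) * s = p' * c - 2 * k * p * s by ring] at h1
  have h3 : |k * F₀ / b * (p' * c - 2 * k * p * s) + F₀ / (2 * b) * (p'' * s + 2 * k * p' * c)|
      ≤ k * F₀ / b * (p * A + 2 * k * p) + F₀ / (2 * b) * (p * B + 2 * k * (p * A)) := by
    refine (abs_add_le _ _).trans ?_
    rw [abs_mul, abs_mul, abs_of_pos (by positivity : 0 < k * F₀ / b),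
      abs_of_pos (by positivity : 0 < F₀ / (2 * b))]
    gcongr
  rw [abs_mul]
  refine (mul_le_mul hv h3 (abs_nonneg _) ((abs_nonneg _).trans hv)).trans_eq ?_
  ring

/-- The set of `T`-periodic solutions of `z' = F_z(t,z)` is bounded in the
Lorentzian case `f(z) = z₀²/(z₀² + z²)`. -/
theorem bounded_periodic_solutions_lorentzian
    (F₀ k b z₀ : ℝ) (hF₀ : 0 < F₀) (hk : 0 < k) (hb : 0 < b) (hz₀ : 0 < z₀)
    (T : ℝ) (hT : T = 4 * Real.pi / b)
    (f : ℝ → ℝ) (hf : f = fun w => z₀ ^ 2 / (z₀ ^ 2 + w ^ 2)) :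
    ∃ D > 0, ∀ z : ℝ → ℝ,
      (∀ t ∈ Set.Icc 0 T, HasDerivWithinAt z (Fz F₀ k b f t (z t)) (Set.Icc 0 T) t) →
      z 0 = z T →
      ∀ t ∈ Set.Icc 0 T, |z t| ≤ D := by
  have hTpos : 0 < T := by rw [hT]; positivity
  set K := k * F₀ + F₀ * (1 / z₀) with hK
  have hKpos : 0 < K := by positivity
  set C := K * (k * F₀ / b * (1 / z₀ + 2 * k)
    + F₀ / (2 * b) * (10 / z₀ ^ 2 + 2 * k * (1 / z₀))) with hC
  have hCpos : 0 < C := by positivity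
  set f' : ℝ → ℝ := fun w => -2 * w * f w ^ 2 / z₀ ^ 2 with hf'
  set f'' : ℝ → ℝ := fun w => -2 * f w ^ 2 / z₀ ^ 2 + 8 * w ^ 2 * f w ^ 3 / z₀ ^ 4 with hf''
  have hd : ∀ x, HasDerivAt f (f' x) x := by
    intro x; simp only [hf', hf]; exact hasDerivAt_lorentzian_s7 hz₀ x
  have hd' : ∀ x, HasDerivAt f' (f'' x) x := by
    intro x; simp only [hf', hf'', hf]; exact hasDerivAt_deriv_lorentzian hz₀ x
  have hpos : ∀ x, 0 < f x := by
    intro x; rw [hf]; exact lorentzian_pos_s7 hz₀ x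
  have hle : ∀ x, f x ≤ 1 := by
    intro x; rw [hf]; exact lorentzian_le_one hz₀ x
  have hA : ∀ x, |f' x| ≤ f x * (1 / z₀) := by
    intro x; simp only [hf', hf]; exact abs_deriv_lorentzian_le hz₀ x
  have hB : ∀ x, |f'' x| ≤ f x * (10 / z₀ ^ 2) := by
    intro x; simp only [hf'', hf]; exact abs_deriv_deriv_lorentzian_le hz₀ x
  have hv : ∀ t x, |Fz F₀ k b f t x| ≤ f x * K := fun t x =>
    abs_Fz_le hF₀.le hk.le t (hpos x).le (by rw [(hd x).deriv]; exact hA x)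
  clear_value f' f''
  refine ⟨C * z₀ ^ 2 / F₀ + K * T, by positivity, fun z hz hper t ht => ?_⟩
  have hzc : ContinuousOn z (Icc 0 T) := fun s hs => (hz s hs).continuousWithinAt
  have hfc : Continuous f := continuous_iff_continuousAt.2 fun x => (hd x).continuousAt
  have hfc' : Continuous f' := continuous_iff_continuousAt.2 fun x => (hd' x).continuousAt
  obtain ⟨c, hc, hc0⟩ := exists_hasDerivAt_eq_zero hTpos
    (f := fun s => z s + k * F₀ / b * (f (z s) * Real.cos (2 * k * z s - b * s))
        + F₀ / (2 * b) * (f' (z s) * Real.sin (2 * k * z s - b * s)))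
    (by
      have h1 := hfc.comp_continuousOn hzc
      have h2 := hfc'.comp_continuousOn hzc
      simp only [Function.comp_def] at h1 h2
      fun_prop)
    (by
      have hbT : b * T = 2 * Real.pi + 2 * Real.pi := by rw [hT]; field_simp; ring
      simp only [hbT, ← hper, mul_zero, sub_zero, ← sub_sub, Real.cos_sub_two_pi,
        Real.sin_sub_two_pi])
    (fun s hs => hasDerivAt_near_identity hb.ne'
      ((hz s (Ioo_subset_Icc_self hs)).hasDerivAt (Icc_mem_nhds hs.1 hs.2))
      (hd (z s)) (hd' (z s)) rfl rfl)
  have hR := abs_remainder_le hF₀ hk hb (hpos (z c)).le (hv c (z c)) (hA (z c)) (hB (z c))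
    (Real.abs_sin_le_one (2 * k * z c - b * c)) (Real.abs_cos_le_one (2 * k * z c - b * c))
  rw [← hC, ← abs_neg, ← eq_neg_of_add_eq_zero_left hc0] at hR
  have hzcb : |z c| ≤ C * z₀ ^ 2 / F₀ := by
    have e : |F₀ / 2 * f' (z c)| = f (z c) ^ 2 * (F₀ * |z c| / z₀ ^ 2) := by
      rw [hf', show F₀ / 2 * (-2 * z c * f (z c) ^ 2 / z₀ ^ 2)
        = -(f (z c) ^ 2 * (F₀ / z₀ ^ 2) * z c) by ring, abs_neg, abs_mul,
        abs_of_nonneg (by positivity)]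
      ring
    rw [e] at hR
    have := le_of_mul_le_mul_left hR (pow_pos (hpos (z c)) 2)
    rw [div_le_iff₀ (by positivity)] at this
    rw [le_div_iff₀ hF₀]
    linarith
  have hmv := (convex_Icc 0 T).norm_image_sub_le_of_norm_hasDerivWithin_le hz
    (fun s _ => (hv s (z s)).trans (mul_le_of_le_one_left hKpos.le (hle (z s))))
    (Ioo_subset_Icc_self hc) ht
  have hdist : |t - c| ≤ T := abs_le.2 ⟨by linarith [ht.1, hc.2], by linarith [ht.2, hc.1]⟩
  calc |z t| = |z c + (z t - z c)| := by ring_nf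
    _ ≤ |z c| + |z t - z c| := abs_add_le _ _
    _ ≤ C * z₀ ^ 2 / F₀ + K * T :=
      add_le_add hzcb (hmv.trans (mul_le_mul_of_nonneg_left hdist hKpos.le))
end

section
/- Let f(z) = exp(−2z²/z₀²) with z₀ > 0. There exists ρ > 0 such that for every λ ∈ (0,1) and every C¹ function z_λ : [0,T] → ℝ satisfying z_λ'(t) = −(1−λ) z_λ(t) + λ F_z(t, z_λ(t)) for all t ∈ [0,T] and z_λ(0) = z_λ(T), one has max_{t ∈ [0,T]} |z_λ(t)| ≤ ρ. -/
open Filter Set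

/-- The force for the Gaussian profile, with the squared cosine linearized. -/
lemma Fz_gaussian (F₀ k b z₀ t z : ℝ) :
    Fz F₀ k b (fun w => Real.exp (-2 * w ^ 2 / z₀ ^ 2)) t z =
      Real.exp (-2 * z ^ 2 / z₀ ^ 2) * (-(k * F₀ * Real.sin (2 * k * z - b * t))
        - 2 * F₀ * z / z₀ ^ 2 * (1 + Real.cos (2 * k * z - b * t))) := by
  have hd : HasDerivAt (fun w : ℝ => Real.exp (-2 * w ^ 2 / z₀ ^ 2))
      (Real.exp (-2 * z ^ 2 / z₀ ^ 2) * (-2 * (2 * z) / z₀ ^ 2)) z := by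
    have h := (((hasDerivAt_pow 2 z).const_mul (-2)).div_const (z₀ ^ 2)).exp
    simpa using h
  have hc : Real.cos (k * z - b * t / 2) ^ 2 = (1 + Real.cos (2 * k * z - b * t)) / 2 := by
    rw [Real.cos_sq, show 2 * (k * z - b * t / 2) = 2 * k * z - b * t by ring]
    ring
  rw [Fz, hd.deriv, hc]
  ring

lemma Fz_gaussian_neg (F₀ k b z₀ t z : ℝ) :
    Fz F₀ k (-b) (fun w => Real.exp (-2 * w ^ 2 / z₀ ^ 2)) t (-z) =
      -Fz F₀ k b (fun w => Real.exp (-2 * w ^ 2 / z₀ ^ 2)) t z := by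
  rw [Fz_gaussian, Fz_gaussian, show 2 * k * -z - -b * t = -(2 * k * z - b * t) by ring,
    Real.sin_neg, Real.cos_neg, neg_sq]
  ring

/-- The Gaussian force decays at least like `1 / z`. -/
lemma abs_Fz_gaussian_mul_le {F₀ k z₀ : ℝ} (hF₀ : 0 < F₀) (hk : 0 < k) (hz₀ : 0 < z₀)
    (b t : ℝ) {z : ℝ} (hz : 1 ≤ z) :
    |Fz F₀ k b (fun w => Real.exp (-2 * w ^ 2 / z₀ ^ 2)) t z| * z
      ≤ k * F₀ * z₀ ^ 2 / 2 + 2 * F₀ := by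
  have hz0 : 0 < z := by linarith
  rw [Fz_gaussian, abs_mul, abs_of_pos (Real.exp_pos _)]
  have hS : |-(k * F₀ * Real.sin (2 * k * z - b * t))
      - 2 * F₀ * z / z₀ ^ 2 * (1 + Real.cos (2 * k * z - b * t))|
      ≤ k * F₀ + 4 * F₀ * z / z₀ ^ 2 := by
    have hp : 0 < k * F₀ := by positivity
    have hq : 0 < 2 * F₀ * z / z₀ ^ 2 := by positivity
    have hq' : 4 * F₀ * z / z₀ ^ 2 = 2 * (2 * F₀ * z / z₀ ^ 2) := by ring
    rw [hq', abs_le]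
    have h1 := Real.sin_le_one (2 * k * z - b * t)
    have h2 := Real.neg_one_le_sin (2 * k * z - b * t)
    have h3 := Real.cos_le_one (2 * k * z - b * t)
    have h4 := Real.neg_one_le_cos (2 * k * z - b * t)
    constructor <;> nlinarith
  have hE : Real.exp (-2 * z ^ 2 / z₀ ^ 2) ≤ z₀ ^ 2 / (2 * z ^ 2) := by
    rw [show -2 * z ^ 2 / z₀ ^ 2 = -(2 * z ^ 2 / z₀ ^ 2) by ring, Real.exp_neg,
      ← inv_div (2 * z ^ 2)]
    have := Real.add_one_le_exp (2 * z ^ 2 / z₀ ^ 2)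
    gcongr
    linarith
  calc _ ≤ z₀ ^ 2 / (2 * z ^ 2) * (k * F₀ + 4 * F₀ * z / z₀ ^ 2) * z := by gcongr
    _ = k * F₀ * z₀ ^ 2 / 2 / z + 2 * F₀ := by field_simp; ring
    _ ≤ _ := by
      gcongr ?_ + _
      exact div_le_self (by positivity) hz

/-- Above the height `m`, the function `w ∘ z - c sin (2kz - bt)` with `w' = exp (2z² / z₀²)`
is strictly decreasing along solutions. -/
lemma lyapunov_deriv_neg {F₀ k b z₀ m lam z t z' : ℝ} (hF₀ : 0 < F₀) (hk : 0 < k) (hb : b ≠ 0)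
    (hz₀ : 0 < z₀) (hlam : lam ∈ Ioo (0 : ℝ) 1) (hm0 : 0 < m)
    (hm : k * z₀ ^ 2 < m) (hm' : 2 * k * F₀ ≤ m * |b|) (hmz : m ≤ z)
    (hF : 4 * k * |Fz F₀ k b (fun w => Real.exp (-2 * w ^ 2 / z₀ ^ 2)) t z| ≤ |b|)
    (hz' : z' = -(1 - lam) * z
      + lam * Fz F₀ k b (fun w => Real.exp (-2 * w ^ 2 / z₀ ^ 2)) t z) :
    Real.exp (2 * z ^ 2 / z₀ ^ 2) * z' - lam * (2 * F₀ * m / z₀ ^ 2) / b *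
      (Real.cos (2 * k * z - b * t) * (2 * k * z' - b)) < 0 := by
  obtain ⟨h0, h1⟩ := hlam
  have hβ : 0 < |b| := abs_pos.mpr hb
  have hz0 : 0 < z := hm0.trans_le hmz
  have hE : 2 * z ^ 2 / z₀ ^ 2 ≤ Real.exp (2 * z ^ 2 / z₀ ^ 2) := by
    linarith [Real.add_one_le_exp (2 * z ^ 2 / z₀ ^ 2)]
  have hfE : Real.exp (2 * z ^ 2 / z₀ ^ 2) * Fz F₀ k b (fun w => Real.exp (-2 * w ^ 2 / z₀ ^ 2)) t z
      = -(k * F₀ * Real.sin (2 * k * z - b * t))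
        - 2 * F₀ * z / z₀ ^ 2 * (1 + Real.cos (2 * k * z - b * t)) := by
    rw [Fz_gaussian, ← mul_assoc, ← Real.exp_add,
      show 2 * z ^ 2 / z₀ ^ 2 + -2 * z ^ 2 / z₀ ^ 2 = 0 by ring, Real.exp_zero, one_mul]
  generalize Fz F₀ k b (fun w => Real.exp (-2 * w ^ 2 / z₀ ^ 2)) t z = F at *
  have hs := Real.neg_one_le_sin (2 * k * z - b * t)
  have hc := Real.neg_one_le_cos (2 * k * z - b * t)
  have hc' := Real.abs_cos_le_one (2 * k * z - b * t)
  generalize Real.sin (2 * k * z - b * t) = s at *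
  generalize Real.cos (2 * k * z - b * t) = c at *
  have hpz : 2 * F₀ * m / z₀ ^ 2 ≤ 2 * F₀ * z / z₀ ^ 2 := by gcongr
  have hp : k * F₀ < (2 * F₀ * m / z₀ ^ 2) / 2 := by
    rw [show (2 * F₀ * m / z₀ ^ 2) / 2 = F₀ * m / z₀ ^ 2 by ring, lt_div_iff₀ (by positivity)]
    nlinarith
  have hpE : (2 * F₀ * m / z₀ ^ 2) * (2 * k / |b|) ≤ Real.exp (2 * z ^ 2 / z₀ ^ 2) := by
    refine le_trans ?_ hE
    rw [div_mul_div_comm, div_le_div_iff₀ (by positivity) (by positivity)]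
    have h3 : m * (2 * k * F₀) ≤ z * (z * |b|) :=
      mul_le_mul hmz (hm'.trans (by gcongr)) (by positivity) hz0.le
    have h4 : 0 < z₀ ^ 2 := by positivity
    nlinarith [mul_le_mul_of_nonneg_left h3 h4.le]
  generalize Real.exp (2 * z ^ 2 / z₀ ^ 2) = E at *
  have hp0 : 0 < 2 * F₀ * m / z₀ ^ 2 := by positivity
  generalize 2 * F₀ * m / z₀ ^ 2 = p at *
  generalize 2 * F₀ * z / z₀ ^ 2 = q at *
  have hzabs : |z'| ≤ (1 - lam) * z + lam * |F| := by
    rw [hz']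
    refine (abs_add_le _ _).trans (le_of_eq ?_)
    rw [abs_mul, abs_mul, abs_neg, abs_of_pos (sub_pos.mpr h1), abs_of_pos hz0, abs_of_pos h0]
  have hkF : 2 * k / |b| * |F| ≤ 1 / 2 := by
    rw [div_mul_eq_mul_div, div_le_div_iff₀ hβ two_pos]
    linarith
  have hcross : -(lam * p * (2 * k / b) * (c * z')) ≤
      lam * p * (2 * k / |b|) * ((1 - lam) * z + lam * |F|) := by
    refine (neg_le_abs _).trans ?_
    rw [abs_mul, abs_mul, abs_mul, abs_of_pos h0, abs_of_pos hp0, abs_div,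
      abs_of_pos (by positivity : 0 < 2 * k), abs_mul]
    gcongr
    calc |c| * |z'| ≤ 1 * |z'| := by gcongr
      _ ≤ _ := by rwa [one_mul]
  have hA : lam * p * (2 * k / |b|) * ((1 - lam) * z) ≤ (1 - lam) * z * E := by
    have hnn : 0 ≤ (1 - lam) * z := mul_nonneg (by linarith) hz0.le
    calc _ = lam * ((1 - lam) * z * (p * (2 * k / |b|))) := by ring
      _ ≤ 1 * ((1 - lam) * z * (p * (2 * k / |b|))) := by gcongr
      _ ≤ _ := by rw [one_mul]; gcongr
  have hB : lam * p * (2 * k / |b|) * (lam * |F|) ≤ lam * (p / 2) := by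
    calc _ = lam * (lam * (p * (2 * k / |b| * |F|))) := by ring
      _ ≤ lam * (1 * (p * (1 / 2))) := by gcongr
      _ = _ := by ring
  have hbr : E * F + p * c ≤ k * F₀ - p := by
    rw [hfE]
    nlinarith [mul_pos hk hF₀]
  have hbr' := mul_le_mul_of_nonneg_left hbr h0.le
  have hlp := mul_lt_mul_of_pos_left hp h0
  have hid : E * z' - lam * p / b * (c * (2 * k * z' - b)) =
      -((1 - lam) * z * E) + lam * (E * F + p * c) + -(lam * p * (2 * k / b) * (c * z')) := by
    have : E * z' = -((1 - lam) * z * E) + lam * (E * F) := by rw [hz']; ring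
    rw [this]
    field_simp
    ring
  rw [hid]
  linarith

/-- A periodic solution cannot stay above the height `m`. -/
lemma exists_lt_of_periodic {F₀ k b z₀ m lam T : ℝ} (hF₀ : 0 < F₀) (hk : 0 < k) (hb : b ≠ 0)
    (hz₀ : 0 < z₀) (hT : 0 < T) (hper : ∀ x, Real.sin (x - b * T) = Real.sin x)
    (hlam : lam ∈ Ioo (0 : ℝ) 1) (hm0 : 0 < m)
    (hm : k * z₀ ^ 2 < m) (hm' : 2 * k * F₀ ≤ m * |b|)
    (hF : ∀ t z, m ≤ z → 4 * k * |Fz F₀ k b (fun w => Real.exp (-2 * w ^ 2 / z₀ ^ 2)) t z| ≤ |b|)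
    {z : ℝ → ℝ}
    (hz : ∀ t ∈ Icc 0 T, HasDerivWithinAt z (-(1 - lam) * z t
      + lam * Fz F₀ k b (fun w => Real.exp (-2 * w ^ 2 / z₀ ^ 2)) t (z t)) (Icc 0 T) t)
    (hzT : z 0 = z T) :
    ∃ t ∈ Icc 0 T, z t < m := by
  by_contra! hcon
  have hcont : Continuous fun x : ℝ => Real.exp (2 * x ^ 2 / z₀ ^ 2) := by fun_prop
  have hw (x : ℝ) : HasDerivAt (fun x => ∫ y in (0 : ℝ)..x, Real.exp (2 * y ^ 2 / z₀ ^ 2))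
      (Real.exp (2 * x ^ 2 / z₀ ^ 2)) x :=
    intervalIntegral.integral_hasDerivAt_right (hcont.intervalIntegrable _ _)
      (hcont.stronglyMeasurableAtFilter _ _) hcont.continuousAt
  set w : ℝ → ℝ := fun x => ∫ y in (0 : ℝ)..x, Real.exp (2 * y ^ 2 / z₀ ^ 2)
  set c := lam * (2 * F₀ * m / z₀ ^ 2) / b
  have hzc : ContinuousOn z (Icc 0 T) := fun t ht => (hz t ht).continuousWithinAt
  have hwc : Continuous w := continuous_iff_continuousAt.mpr fun x => (hw x).continuousAt
  obtain ⟨t, ht, h0⟩ := exists_hasDerivAt_eq_zero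
    (f := fun t => w (z t) - c * Real.sin (2 * k * z t - b * t)) hT
    ((hwc.comp_continuousOn hzc).sub (by fun_prop))
    (by
      have h := hper (2 * k * z T)
      simp only [mul_zero, sub_zero, hzT, h])
    (fun t ht => by
      have hd := (hz t (Ioo_subset_Icc_self ht)).hasDerivAt (Icc_mem_nhds ht.1 ht.2)
      have hφ := (hd.const_mul (2 * k)).sub ((hasDerivAt_id t).const_mul b)
      exact ((hw (z t)).comp t hd).sub (hφ.sin.const_mul c))
  have htI := Ioo_subset_Icc_self ht
  have hneg := lyapunov_deriv_neg hF₀ hk hb hz₀ hlam hm0 hm hm' (hcon t htI)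
    (hF t _ (hcon t htI)) rfl
  simp only [mul_one, id] at h0
  exact hneg.ne h0

/-- A periodic function that dips below `m` and whose slope above `m` is at most `C` stays below
`m + 2 (C + 1) T`. -/
lemma le_of_periodic_of_slope_le {z v : ℝ → ℝ} {m C T : ℝ} (hC : 0 ≤ C)
    (hz : ∀ t ∈ Icc 0 T, HasDerivWithinAt z (v t) (Icc 0 T) t)
    (hv : ∀ t ∈ Icc 0 T, m ≤ z t → v t ≤ C) (hzT : z 0 = z T)
    {t₁ : ℝ} (ht₁ : t₁ ∈ Icc 0 T) (h₁ : z t₁ ≤ m) {t : ℝ} (ht : t ∈ Icc 0 T) :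
    z t ≤ m + 2 * (C + 1) * T := by
  have key (a A : ℝ) (ha : a ∈ Icc 0 T) (hA : m ≤ A) (hza : z a ≤ A) :
      ∀ s ∈ Icc a T, z s ≤ A + (C + 1) * (s - a) := by
    have hB (x : ℝ) : HasDerivAt (fun s => A + (C + 1) * (s - a)) (C + 1) x := by
      simpa using (((hasDerivAt_id x).sub_const a).const_mul (C + 1)).const_add A
    intro s hs
    refine image_le_of_deriv_right_lt_deriv_boundary (f' := v) (B' := fun _ => C + 1)
      (fun x hx => ((hz x ⟨ha.1.trans hx.1, hx.2⟩).continuousWithinAt).mono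
        (Icc_subset_Icc_left ha.1))
      (fun x hx => ?_) (by simpa using hza) hB (fun x hx hxe => ?_) hs
    · have hx0 : 0 ≤ x := ha.1.trans hx.1
      exact (hz x ⟨hx0, hx.2.le⟩).mono_of_mem_nhdsWithin
        (mem_of_superset (Icc_mem_nhdsGE hx.2) (Icc_subset_Icc_left hx0))
    · have hx0 : 0 ≤ x := ha.1.trans hx.1
      have : 0 ≤ (C + 1) * (x - a) := mul_nonneg (by linarith) (by linarith [hx.1])
      linarith [hv x ⟨hx0, hx.2.le⟩ (by linarith)]
  have hT : 0 ≤ T := ht.1.trans ht.2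
  have hz0 : z 0 ≤ m + (C + 1) * T := by
    rw [hzT]
    refine (key t₁ m ht₁ le_rfl h₁ T ⟨ht₁.2, le_rfl⟩).trans ?_
    have := ht₁.1
    gcongr
    linarith
  have hA : m ≤ m + (C + 1) * T := le_add_of_nonneg_right (by positivity)
  have hle := key 0 _ ⟨le_rfl, hT⟩ hA hz0 t ht
  have := ht.2
  calc z t ≤ m + (C + 1) * T + (C + 1) * (t - 0) := hle
    _ ≤ m + (C + 1) * T + (C + 1) * T := by gcongr; linarith
    _ = _ := by ring

/-- The uniform upper bound, for frequencies `b` of either sign. -/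
lemma exists_upper_bound {F₀ k b z₀ T : ℝ} (hF₀ : 0 < F₀) (hk : 0 < k) (hb : b ≠ 0)
    (hz₀ : 0 < z₀) (hT : 0 < T) (hper : ∀ x, Real.sin (x - b * T) = Real.sin x) :
    ∃ ρ > 0, ∀ lam ∈ Ioo (0 : ℝ) 1, ∀ z : ℝ → ℝ,
      (∀ t ∈ Icc 0 T, HasDerivWithinAt z (-(1 - lam) * z t
        + lam * Fz F₀ k b (fun w => Real.exp (-2 * w ^ 2 / z₀ ^ 2)) t (z t)) (Icc 0 T) t) →
      z 0 = z T → ∀ t ∈ Icc 0 T, z t ≤ ρ := by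
  have hβ : 0 < |b| := abs_pos.mpr hb
  set C := k * F₀ * z₀ ^ 2 / 2 + 2 * F₀
  have hC : 0 < C := by positivity
  set m := 1 + 4 * k * C / |b| + 2 * k * F₀ / |b| + k * z₀ ^ 2
  have ha : 0 < 4 * k * C / |b| := by positivity
  have hb' : 0 < 2 * k * F₀ / |b| := by positivity
  have hc : 0 < k * z₀ ^ 2 := by positivity
  have hm1 : 1 ≤ m := by linarith
  have hdecay (t z : ℝ) (hz : m ≤ z) :
      |Fz F₀ k b (fun w => Real.exp (-2 * w ^ 2 / z₀ ^ 2)) t z| * z ≤ C :=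
    abs_Fz_gaussian_mul_le hF₀ hk hz₀ b t (hm1.trans hz)
  have hF (t z : ℝ) (hz : m ≤ z) :
      4 * k * |Fz F₀ k b (fun w => Real.exp (-2 * w ^ 2 / z₀ ^ 2)) t z| ≤ |b| := by
    have h1 : 4 * k * C ≤ z * |b| := (div_le_iff₀ hβ).mp (by linarith)
    have h2 := mul_le_mul_of_nonneg_left (hdecay t z hz) (by positivity : 0 ≤ 4 * k)
    refine le_of_mul_le_mul_right (a := z) ?_ (by linarith)
    linarith
  refine ⟨m + 2 * (C + 1) * T, by positivity, fun lam hlam z hz hzT t ht => ?_⟩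
  obtain ⟨t₁, ht₁, h₁⟩ := exists_lt_of_periodic hF₀ hk hb hz₀ hT hper hlam (by linarith)
    (by linarith : k * z₀ ^ 2 < m) ((div_le_iff₀ hβ).mp (by linarith)) hF hz hzT
  refine le_of_periodic_of_slope_le hC.le hz (fun s _ hs => ?_) hzT ht₁ h₁.le ht
  have h := hdecay s (z s) hs
  have hFC := (le_mul_of_one_le_right (abs_nonneg _) (hm1.trans hs)).trans h
  have hzpos : 0 ≤ (1 - lam) * z s := mul_nonneg (by linarith [hlam.2]) (by linarith)
  have h4 := mul_le_mul_of_nonneg_left ((le_abs_self _).trans hFC) hlam.1.le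
  nlinarith [hlam.2]

/-- Uniform a priori bound for the homotopy problem
`z' = −(1−λ)z + λ F_z(t,z)`, `z(0) = z(T)`, `λ ∈ (0,1)`, in the Gaussian case
`f(z) = exp(−2z²/z₀²)`. -/
theorem homotopy_bound_gaussian
    (F₀ k b z₀ : ℝ) (hF₀ : 0 < F₀) (hk : 0 < k) (hb : 0 < b) (hz₀ : 0 < z₀)
    (T : ℝ) (hT : T = 4 * Real.pi / b)
    (f : ℝ → ℝ) (hf : f = fun w => Real.exp (-2 * w ^ 2 / z₀ ^ 2)) :
    ∃ ρ > 0, ∀ lam : ℝ, lam ∈ Set.Ioo (0:ℝ) 1 → ∀ z : ℝ → ℝ,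
      (∀ t ∈ Set.Icc 0 T,
        HasDerivWithinAt z (-(1 - lam) * z t + lam * Fz F₀ k b f t (z t)) (Set.Icc 0 T) t) →
      z 0 = z T →
      ∀ t ∈ Set.Icc 0 T, |z t| ≤ ρ := by
  subst hf
  have hT0 : 0 < T := by rw [hT]; positivity
  have hbT : b * T = 2 * (2 * Real.pi) := by rw [hT]; field_simp; ring
  have hper (x : ℝ) : Real.sin (x - b * T) = Real.sin x := by
    rw [hbT]
    exact_mod_cast Real.sin_sub_nat_mul_two_pi x 2
  have hper' (x : ℝ) : Real.sin (x - -b * T) = Real.sin x := by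
    rw [← hper (x - -b * T)]
    ring_nf
  obtain ⟨ρ₁, hρ₁, h₁⟩ := exists_upper_bound hF₀ hk hb.ne' hz₀ hT0 hper
  obtain ⟨ρ₂, -, h₂⟩ := exists_upper_bound hF₀ hk (neg_ne_zero.mpr hb.ne') hz₀ hT0 hper'
  refine ⟨max ρ₁ ρ₂, lt_max_of_lt_left hρ₁, fun lam hlam z hz hzT t ht => abs_le'.mpr ⟨?_, ?_⟩⟩
  · exact (h₁ lam hlam z hz hzT t ht).trans (le_max_left _ _)
  · refine (h₂ lam hlam (fun s => -z s) (fun s hs => ?_) (by simp [hzT]) t ht).trans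
      (le_max_right _ _)
    refine (hz s hs).fun_neg.congr_deriv ?_
    rw [Fz_gaussian_neg]
    ring
end

section
/- Let I = [a,b] ⊂ ℝ and n ≥ 1. Let g : C(I,ℝⁿ) → L¹(I,ℝⁿ) and h : C(I,ℝⁿ) → ℝⁿ be continuous operators such that for every ρ > 0 the function t ↦ sup{‖g(x)(t)‖ : x ∈ C(I,ℝⁿ), ‖x‖_C ≤ ρ} is in L¹(I) and sup{‖h(x)‖ : ‖x‖_C ≤ ρ} < ∞. Let p : C(I,ℝⁿ) × C(I,ℝⁿ) → L¹(I,ℝⁿ) and l : C(I,ℝⁿ) × C(I,ℝⁿ) → ℝⁿ be continuous operators such that: (1) for each fixed x, the maps y ↦ p(x,y) and y ↦ l(x,y) are linear; (2) ‖p(x,y)(t)‖ ≤ α(t, ‖x‖_C) ‖y‖_C and ‖l(x,y)‖ ≤ α₀(‖x‖_C) ‖y‖_C, where α₀ : ℝ⁺ → ℝ⁺ is nondecreasing and α : I × ℝ⁺ → ℝ⁺ is nondecreasing in the second argument and integrable in the first; (3) there exists β > 0 such that for all x ∈ C(I,ℝⁿ), q ∈ L¹(I,ℝⁿ), c₀ ∈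 ℝⁿ, every absolutely continuous solution of y'(t) = p(x,y)(t) + q(t) a.e. with l(x,y) = c₀ satisfies ‖y‖_C ≤ β(‖c₀‖ + ‖q‖_{L¹}). Suppose there exists ρ > 0 such that for every λ ∈ (0,1), every absolutely continuous solution x of x'(t) = p(x,x)(t) + λ(g(x)(t) − p(x,x)(t)) a.e. with l(x,x) = λ(l(x,x) − h(x)) satisfies ‖x‖_C ≤ ρ. Then the boundary-value problem x'(t) = g(x)(t) a.e. on I, h(x) = 0 possesses at least one absolutely continuous solution. -/
open Filter Set intervalIntegral MeasureTheory

theorem exists_det_one_add_quadrature (E : Type*) [NormedAddCommGroup E] [NormedSpace ℝ E]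
    [FiniteDimensional ℝ E] {ε : ℝ} (hε : 0 < ε) :
    ∃ (s : Finset ℝ) (w : ℝ → ℝ), (∀ t ∈ s, 0 ≤ t ∧ t < ε) ∧ ∑ t ∈ s, w t = 1 ∧
      ∀ A : E →L[ℝ] E, ∑ t ∈ s, w t * (1 + t • A).det = (1 + A).det := by
  classical
  let d := Module.finrank ℝ E
  obtain ⟨s, hs, hcard⟩ := (Set.Ico_infinite hε).exists_subset_card_eq (d + 1)
  have hinj : Set.InjOn (id : ℝ → ℝ) (s : Set ℝ) := Set.injOn_id _
  refine ⟨s, fun t => (Lagrange.basis s id t).eval 1, fun t ht => hs ht, ?_, fun A => ?_⟩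
  · rw [← Polynomial.eval_finsetSum, Lagrange.sum_basis hinj (by
      rw [← Finset.card_pos, hcard]; omega), Polynomial.eval_one]
  · let bs := Module.finBasis ℝ E
    let M := LinearMap.toMatrix bs bs (A : E →ₗ[ℝ] E)
    let P : Polynomial ℝ := Matrix.det ((Polynomial.X : Polynomial ℝ) • M.map Polynomial.C
      + (1 : Matrix (Fin d) (Fin d) ℝ).map Polynomial.C)
    have hP : ∀ t : ℝ, P.eval t = (1 + t • A).det := by
      intro t
      have h1 : (1 + t • A).det = LinearMap.det (1 + t • (A : E →ₗ[ℝ] E)) := rfl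
      have h2 : LinearMap.toMatrix bs bs (1 + t • (A : E →ₗ[ℝ] E)) = 1 + t • M := by
        rw [map_add, map_smul, LinearMap.toMatrix_one]
      rw [h1, ← LinearMap.det_toMatrix bs, h2, ← Polynomial.coe_evalRingHom, RingHom.map_det]
      congr 1
      ext i j
      by_cases hij : i = j <;>
        simp [Matrix.map_apply, add_comm, hij, mul_comm t]
    have hdeg : P.degree < s.card := by
      have := Polynomial.natDegree_det_X_add_C_le M 1
      rw [hcard]
      refine lt_of_le_of_lt Polynomial.degree_le_natDegree ?_
      rw [Fintype.card_fin] at this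
      exact_mod_cast Nat.lt_succ_of_le this
    have := congrArg (Polynomial.eval 1) (Lagrange.eq_interpolate hinj hdeg)
    rw [hP, Lagrange.interpolate_apply, Polynomial.eval_finsetSum] at this
    rw [one_smul] at this
    rw [this]
    refine Finset.sum_congr rfl fun t _ => ?_
    simp [hP, mul_comm]

theorem lipschitz_indicator_closedBall {E : Type*} [NormedAddCommGroup E] [NormedSpace ℝ E]
    {g : E → E} {K : NNReal} (hg : LipschitzOnWith K g (Metric.closedBall 0 1))
    (h0 : ∀ x, ‖x‖ = 1 → g x = 0) :
    LipschitzWith (2 * K) ((Metric.closedBall (0 : E) 1).indicator g) := by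
  have key : ∀ x y : E, ‖x‖ ≤ 1 → ¬ ‖y‖ ≤ 1 → ‖g x‖ ≤ 2 * K * ‖x - y‖ := by
    intro x y hx hy
    push Not at hy
    have hy0 : ‖y‖ ≠ 0 := by linarith
    have hz : ‖(‖y‖⁻¹ • y)‖ = 1 := by
      rw [norm_smul, norm_inv, norm_norm, inv_mul_cancel₀ hy0]
    have h1 := hg.norm_sub_le (x := x) (y := ‖y‖⁻¹ • y) (by simpa using hx) (by simp [hz])
    rw [h0 _ hz, sub_zero] at h1
    have h2 : ‖y - ‖y‖⁻¹ • y‖ = ‖y‖ - 1 := by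
      have : y - ‖y‖⁻¹ • y = (1 - ‖y‖⁻¹) • y := by rw [sub_smul, one_smul]
      rw [this, norm_smul, Real.norm_of_nonneg, sub_mul, inv_mul_cancel₀ hy0, one_mul]
      exact sub_nonneg.2 (inv_le_one_of_one_le₀ hy.le)
    have h3 : ‖x - ‖y‖⁻¹ • y‖ ≤ ‖x - y‖ + (‖y‖ - 1) := by
      rw [← h2]; exact norm_sub_le_norm_sub_add_norm_sub _ _ _
    have h4 : ‖y‖ - ‖x‖ ≤ ‖x - y‖ := by rw [norm_sub_rev]; exact norm_sub_norm_le _ _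
    calc ‖g x‖ ≤ K * ‖x - ‖y‖⁻¹ • y‖ := h1
      _ ≤ K * (2 * ‖x - y‖) := by gcongr; linarith
      _ = _ := by ring
  classical
  refine LipschitzWith.of_dist_le_mul fun x y => ?_
  simp only [dist_eq_norm, Set.indicator_apply, mem_closedBall_zero_iff]
  push_cast
  split_ifs with hx hy hy
  · have := hg.norm_sub_le (x := x) (y := y) (by simpa using hx) (by simpa using hy)
    have h5 : 0 ≤ K * ‖x - y‖ := by positivity
    linarith
  · simpa using key x y hx hy
  · rw [zero_sub, norm_neg, norm_sub_rev]; exact key y x hy hx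
  · simp only [sub_zero, norm_zero]; positivity

theorem bijective_add_of_lipschitzWith {E : Type*} [NormedAddCommGroup E] [CompleteSpace E]
    {g : E → E} {K : NNReal} (hK : K < 1) (hg : LipschitzWith K g) :
    Function.Bijective fun x => x + g x := by
  constructor
  · intro x y hxy
    have h1 : x - y = g y - g x := by
      have : x + g x = y + g y := hxy
      rw [sub_eq_sub_iff_add_eq_add, this, add_comm]
    have h2 := hg.norm_sub_le y x
    rw [← h1, norm_sub_rev y x] at h2
    have h3 : (K : ℝ) < 1 := by exact_mod_cast hK
    rw [← sub_eq_zero, ← norm_eq_zero]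
    nlinarith [norm_nonneg (x - y)]
  · intro y
    have hc : ContractingWith K fun x => y - g x :=
      ⟨hK, LipschitzWith.of_dist_le_mul fun a b => by
        rw [dist_sub_left]; exact hg.dist_le_mul a b⟩
    have := hc.fixedPoint_isFixedPt
    refine ⟨ContractingWith.fixedPoint _ hc, ?_⟩
    have h2 : y - g (ContractingWith.fixedPoint _ hc) = ContractingWith.fixedPoint _ hc := this
    exact (sub_eq_iff_eq_add.1 h2).symm

theorem image_ball_of_bijective_of_eq_self {E : Type*} [SeminormedAddCommGroup E] {F : E → E}
    (hF : Function.Bijective F) (hid : ∀ x, x ∉ Metric.ball (0 : E) 1 → F x = x) :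
    F '' Metric.ball 0 1 = Metric.ball 0 1 := by
  rw [← compl_inj_iff, ← Set.image_compl_eq hF]
  ext y
  constructor
  · rintro ⟨x, hx, rfl⟩
    rwa [hid x hx]
  · exact fun hy => ⟨y, hy, hid y hy⟩

theorem det_fderiv_eq_zero_of_norm_eq_one {E : Type*} [NormedAddCommGroup E]
    [InnerProductSpace ℝ E] [FiniteDimensional ℝ E] {r : E → E} {x : E}
    (hd : DifferentiableAt ℝ r x) (h : ∀ᶠ y in nhds x, ‖r y‖ = 1) :
    (fderiv ℝ r x).det = 0 := by
  by_contra hne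
  have h1 : HasFDerivAt (fun y => inner ℝ (r y) (r y))
      ((fderivInnerCLM ℝ (r x, r x)).comp ((fderiv ℝ r x).prod (fderiv ℝ r x))) x :=
    hd.hasFDerivAt.inner ℝ hd.hasFDerivAt
  have h2 : (fun y => inner ℝ (r y) (r y)) =ᶠ[nhds x] fun _ => (1 : ℝ) := by
    filter_upwards [h] with y hy
    rw [real_inner_self_eq_norm_sq, hy, one_pow]
  have h3 := h1.unique ((hasFDerivAt_const (1 : ℝ) x).congr_of_eventuallyEq h2)
  obtain ⟨v, hv⟩ := (LinearMap.equivOfDetNeZero (fderiv ℝ r x : E →ₗ[ℝ] E) hne).surjective (r x)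
  have hv' : fderiv ℝ r x v = r x := hv
  have h4 := DFunLike.congr_fun h3 v
  have h5 : ‖r x‖ = 1 := h.self_of_nhds
  simp [hv', h5] at h4

theorem integral_det_of_image_eq {E : Type*} [NormedAddCommGroup E] [InnerProductSpace ℝ E]
    [FiniteDimensional ℝ E] [MeasurableSpace E] [BorelSpace E] {s : Set E} (hs : MeasurableSet s)
    {F : E → E} {F' : E → E →L[ℝ] E} (hF' : ∀ x ∈ s, HasFDerivWithinAt F (F' x) s x)
    (hinj : Set.InjOn F s) (himg : F '' s = s) (hpos : ∀ x ∈ s, 0 ≤ (F' x).det)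
    (hint : IntegrableOn (fun x => (F' x).det) s) :
    ∫ x in s, (F' x).det = volume.real s := by
  have h1 := lintegral_abs_det_fderiv_eq_addHaar_image volume hs hF' hinj
  have h2 : 0 ≤ᵐ[volume.restrict s] fun x => (F' x).det :=
    (ae_restrict_iff' hs).2 (Eventually.of_forall hpos)
  have h3 : ∫⁻ x in s, ENNReal.ofReal |(F' x).det| = ∫⁻ x in s, ENNReal.ofReal (F' x).det :=
    setLIntegral_congr_fun hs fun x hx => by simp only [abs_of_nonneg (hpos x hx)]
  rw [h3, himg, ← ofReal_integral_eq_lintegral_ofReal hint h2] at h1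
  rw [Measure.real, ← h1, ENNReal.toReal_ofReal (integral_nonneg_of_ae h2)]

theorem not_exists_contDiffAt_retraction {E : Type*} [NormedAddCommGroup E]
    [InnerProductSpace ℝ E] [FiniteDimensional ℝ E] {r : E → E}
    (hr : ∀ x ∈ Metric.closedBall (0 : E) 1, ContDiffAt ℝ 1 r x)
    (hnorm : ∀ x ∈ Metric.closedBall (0 : E) 1, ‖r x‖ = 1)
    (hid : ∀ x, ‖x‖ = 1 → r x = x) : False := by
  borelize E
  let B : Set E := Metric.ball 0 1
  let g : E → E := fun x => r x - x
  have hBc : B ⊆ Metric.closedBall 0 1 := Metric.ball_subset_closedBall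
  have hg : ∀ x ∈ Metric.closedBall (0 : E) 1, ContDiffAt ℝ 1 g x := fun x hx =>
    (hr x hx).sub contDiffAt_id
  obtain ⟨K, hK⟩ : ∃ K, LipschitzOnWith K g (Metric.closedBall 0 1) := by
    refine LocallyLipschitzOn.exists_lipschitzOnWith_of_compact (isCompact_closedBall _ _) ?_
    exact fun x hx => (hg x hx).contDiffWithinAt.exists_lipschitzOnWith (convex_closedBall _ _)
  have hgi := lipschitz_indicator_closedBall hK fun x hx => by simp [g, hid x hx]
  set G := (Metric.closedBall (0 : E) 1).indicator g with hG
  have hG0 : ∀ x, x ∉ B → G x = 0 := by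
    intro x hx
    rw [hG]
    by_cases h : x ∈ Metric.closedBall (0 : E) 1
    · have : ‖x‖ = 1 := le_antisymm (by simpa using h) (by simpa [B] using hx)
      rw [Set.indicator_of_mem h]
      simp [g, hid x this]
    · exact Set.indicator_of_notMem h _
  have hGd : ∀ x ∈ B, HasFDerivAt G (fderiv ℝ r x - 1) x := by
    intro x hx
    have h1 : HasFDerivAt g (fderiv ℝ r x - 1) x :=
      ((hr x (hBc hx)).differentiableAt one_ne_zero).hasFDerivAt.sub (hasFDerivAt_id x)
    refine h1.congr_of_eventuallyEq ?_
    filter_upwards [Metric.isOpen_ball.mem_nhds hx] with y hy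
    exact Set.indicator_of_mem (hBc hy) _
  have hGn : ∀ x ∈ B, ‖fderiv ℝ r x - 1‖ ≤ 2 * K := by
    intro x hx
    have := (hGd x hx).le_of_lipschitz hgi
    simpa using this
  have hint : ∀ t : ℝ, IntegrableOn (fun x => (1 + t • (fderiv ℝ r x - 1)).det) B := by
    intro t
    have : ContinuousOn (fun x => (1 + t • (fderiv ℝ r x - 1)).det)
        (Metric.closedBall (0 : E) 1) := by
      refine ContinuousLinearMap.continuous_det.comp_continuousOn ?_
      have : ContinuousOn (fderiv ℝ r) (Metric.closedBall (0 : E) 1) := fun x hx =>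
        ((hr x hx).fderiv_right (m := 0) le_rfl).continuousAt.continuousWithinAt
      fun_prop
    exact (this.integrableOn_compact (isCompact_closedBall _ _)).mono_set hBc
  obtain ⟨δ, hδ, hdet⟩ : ∃ δ > 0, ∀ A : E →L[ℝ] E, ‖A‖ < δ → 0 < (1 + A).det := by
    have h1 : ContinuousAt (fun A : E →L[ℝ] E => (1 + A).det) 0 :=
      (ContinuousLinearMap.continuous_det.comp (continuous_const.add continuous_id)).continuousAt
    have h2 : (0 : ℝ) < (1 + (0 : E →L[ℝ] E)).det := by
      rw [add_zero]
      exact lt_of_lt_of_eq one_pos LinearMap.det_id.symm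
    obtain ⟨δ, hδ, h⟩ := Metric.eventually_nhds_iff.1 (h1.eventually_const_lt h2)
    exact ⟨δ, hδ, fun A hA => h (by simpa using hA)⟩
  obtain ⟨s, w, hs, hw, hquad⟩ := exists_det_one_add_quadrature E
    (ε := min 1 δ / (2 * K + 1)) (by positivity)
  have hsmall : ∀ t ∈ s, ∫ x in B, (1 + t • (fderiv ℝ r x - 1)).det = volume.real B := by
    intro t ht
    obtain ⟨ht0, ht1⟩ := hs t ht
    rw [lt_div_iff₀ (by positivity)] at ht1
    have ht2 : t * (2 * K) < min 1 δ := lt_of_le_of_lt (by nlinarith) ht1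
    have hLip : LipschitzWith (t.toNNReal * (2 * K)) fun x => t • G x := by
      refine LipschitzWith.of_dist_le_mul fun x y => ?_
      rw [dist_smul₀, Real.norm_of_nonneg ht0]
      have := hgi.dist_le_mul x y
      push_cast at this ⊢
      rw [Real.coe_toNNReal _ ht0, mul_assoc]
      gcongr
    have hbij := bijective_add_of_lipschitzWith (by
      rw [← NNReal.coe_lt_coe]
      push_cast
      rw [Real.coe_toNNReal _ ht0]
      exact ht2.trans_le (min_le_left _ _)) hLip
    refine integral_det_of_image_eq Metric.isOpen_ball.measurableSet (F := fun x => x + t • G x)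
      (fun x hx => ?_) hbij.injective.injOn (image_ball_of_bijective_of_eq_self hbij fun x hx => ?_)
      (fun x hx => (hdet _ ?_).le) (hint t)
    · exact ((hasFDerivAt_id x).add ((hGd x hx).const_smul t)).hasFDerivWithinAt
    · simp [hG0 x hx]
    · rw [norm_smul, Real.norm_of_nonneg ht0]
      refine lt_of_le_of_lt ?_ (ht2.trans_le (min_le_right _ _))
      gcongr
      exact hGn x hx
  have hzero : ∀ x ∈ B, (1 + (fderiv ℝ r x - 1)).det = 0 := by
    intro x hx
    rw [add_sub_cancel]
    refine det_fderiv_eq_zero_of_norm_eq_one ((hr x (hBc hx)).differentiableAt one_ne_zero) ?_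
    filter_upwards [Metric.isOpen_ball.mem_nhds hx] with y hy
    exact hnorm y (hBc hy)
  have hvol : volume.real B = 0 := by
    calc volume.real B = ∑ t ∈ s, w t * ∫ x in B, (1 + t • (fderiv ℝ r x - 1)).det := by
          rw [Finset.sum_congr rfl fun t ht => by rw [hsmall t ht], ← Finset.sum_mul, hw, one_mul]
      _ = ∫ x in B, ∑ t ∈ s, w t * (1 + t • (fderiv ℝ r x - 1)).det := by
          rw [integral_finsetSum _ fun t _ => (hint t).const_mul _]
          simp_rw [MeasureTheory.integral_const_mul]
      _ = ∫ x in B, (0 : ℝ) :=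
          setIntegral_congr_fun Metric.isOpen_ball.measurableSet fun x hx => by
            simp only [hquad, hzero x hx]
      _ = 0 := by simp
  have hpos : 0 < volume B := Metric.measure_ball_pos _ _ one_pos
  exact (ENNReal.toReal_pos hpos.ne' measure_ball_lt_top.ne).ne' hvol

theorem exists_fixedPoint_closedBall_of_contDiff {E : Type*} [NormedAddCommGroup E]
    [InnerProductSpace ℝ E] [FiniteDimensional ℝ E] {f : E → E} (hf : ContDiff ℝ 1 f)
    (hmem : ∀ x, ‖f x‖ ≤ 1) : ∃ x, f x = x := by
  by_contra! hne
  let u : E → E := fun x => x - f x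
  have hu : ContDiff ℝ 1 u := contDiff_id.sub hf
  have hu0 : ∀ x, 0 < ‖u x‖ ^ 2 := fun x => by
    have : u x ≠ 0 := sub_ne_zero.2 (hne x).symm
    positivity
  let D : E → ℝ := fun x => inner ℝ x (u x) ^ 2 + ‖u x‖ ^ 2 * (1 - ‖x‖ ^ 2)
  have hsph : ∀ x, ‖x‖ = 1 → 0 < inner ℝ x (u x) := by
    intro x hx
    have h1 : inner ℝ x (u x) = 1 - inner ℝ x (f x) := by
      simp [u, inner_sub_right, hx]
    have h2 := real_inner_le_norm x (f x)
    rw [hx, one_mul] at h2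
    rcases lt_or_eq_of_le (h2.trans (hmem x)) with h | h
    · linarith
    · have h3 : ‖f x‖ = 1 := le_antisymm (hmem x) (h ▸ h2)
      exact absurd ((inner_eq_one_iff_of_norm_eq_one hx h3).1 h).symm (hne x)
  have hD : ∀ x ∈ Metric.closedBall (0 : E) 1, 0 < D x := by
    intro x hx
    rw [mem_closedBall_zero_iff] at hx
    rcases lt_or_eq_of_le hx with h | h
    · have : 0 < 1 - ‖x‖ ^ 2 := by nlinarith [norm_nonneg x]
      have := mul_pos (hu0 x) this
      positivity
    · have := hsph x h
      simp only [D, h]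
      norm_num
      positivity
  let c : E → ℝ := fun x => (-inner ℝ x (u x) + √(D x)) / ‖u x‖ ^ 2
  refine not_exists_contDiffAt_retraction (r := fun x => x + c x • u x) ?_ ?_ ?_
  · intro x hx
    have h1 : ContDiffAt ℝ 1 u x := hu.contDiffAt
    have h2 : ContDiffAt ℝ 1 (fun x => inner ℝ x (u x)) x := contDiffAt_id.inner ℝ h1
    have h3 : ContDiffAt ℝ 1 D x :=
      (h2.pow 2).add ((h1.norm_sq ℝ).mul (contDiffAt_const.sub (contDiffAt_id.norm_sq ℝ)))
    have h4 : ContDiffAt ℝ 1 c x :=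
      (h2.neg.add (h3.sqrt (hD x hx).ne')).div (h1.norm_sq ℝ) (hu0 x).ne'
    exact contDiffAt_id.add (h4.smul h1)
  · intro x hx
    have h1 : ‖x + c x • u x‖ ^ 2 = 1 := by
      have h2 : c x * ‖u x‖ ^ 2 = -inner ℝ x (u x) + √(D x) := div_mul_cancel₀ _ (hu0 x).ne'
      have h3 := Real.sq_sqrt (hD x hx).le
      have h4 : ‖u x‖ ^ 2 * (‖x‖ ^ 2 + 2 * (c x * inner ℝ x (u x)) + c x ^ 2 * ‖u x‖ ^ 2)
          = ‖u x‖ ^ 2 * 1 := by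
        have h5 : √(D x) = c x * ‖u x‖ ^ 2 + inner ℝ x (u x) := by rw [h2]; ring
        rw [h5] at h3
        simp only [D] at h3
        linear_combination h3
      rw [norm_add_sq_real, inner_smul_right, norm_smul, mul_pow, Real.norm_eq_abs, sq_abs]
      exact mul_left_cancel₀ (hu0 x).ne' h4
    exact (pow_eq_one_iff_of_nonneg (norm_nonneg _) two_ne_zero).1 h1
  · intro x hx
    have : D x = inner ℝ x (u x) ^ 2 := by simp [D, hx]
    simp [c, this, Real.sqrt_sq (hsph x hx).le]

/-- **Brouwer's fixed point theorem** for maps of a Euclidean space into its unit ball. -/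
theorem exists_fixedPoint_of_continuous_of_norm_le_one {E : Type*} [NormedAddCommGroup E]
    [InnerProductSpace ℝ E] [FiniteDimensional ℝ E] {f : E → E} (hf : Continuous f)
    (hmem : ∀ x, ‖f x‖ ≤ 1) : ∃ x, f x = x := by
  by_contra! hne
  obtain ⟨z, -, hz⟩ := (isCompact_closedBall (0 : E) 1).exists_isMinOn
    ⟨0, by simp⟩ (f := fun x => ‖f x - x‖) (by fun_prop)
  have hε : 0 < ‖f z - z‖ := norm_pos_iff.2 (sub_ne_zero.2 (hne z))
  obtain ⟨g, hg⟩ := exists_contMDiffMap_forall_mem_convex_of_local_const (modelWithCornersSelf ℝ E)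
    (n := 1) (t := fun x => Metric.closedBall 0 1 ∩ Metric.ball (f x) ‖f z - z‖)
    (fun x => (convex_closedBall _ _).inter (convex_ball _ _)) (fun x => ⟨f x, by
      filter_upwards [hf.continuousAt.eventually (Metric.ball_mem_nhds (f x) hε)] with y hy
      exact ⟨by simpa using hmem x, Metric.mem_ball_comm.1 hy⟩⟩)
  obtain ⟨x, hx⟩ := exists_fixedPoint_closedBall_of_contDiff (f := g) g.contMDiff.contDiff
    fun x => by simpa using (hg x).1
  have h1 : x ∈ Metric.closedBall (0 : E) 1 := hx ▸ (hg x).1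
  have h2 := (hg x).2
  rw [hx, Metric.mem_ball, dist_comm, dist_eq_norm] at h2
  exact (hz h1).not_gt h2

/-- **Schauder's fixed point theorem** for a ball centred at the origin. -/
theorem exists_fixedPoint_of_continuousOn_closedBall {X : Type*} [NormedAddCommGroup X]
    [NormedSpace ℝ X] {R : ℝ} {T : X → X} {S : Set X} (hR : 0 ≤ R)
    (hT : ContinuousOn T (Metric.closedBall 0 R)) (hS : IsCompact S)
    (hSR : S ⊆ Metric.closedBall 0 R) (hmaps : MapsTo T (Metric.closedBall 0 R) S) :
    ∃ x ∈ Metric.closedBall (0 : X) R, T x = x := by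
  have happrox : ∀ ε > 0, ∃ x ∈ Metric.closedBall (0 : X) R, ‖T x - x‖ ≤ ε := by
    intro ε hε
    obtain ⟨k, hkS, hkfin, hcover⟩ := hS.finite_cover_balls hε
    have : Fintype k := hkfin.fintype
    let m : EuclideanSpace ℝ k → ℝ := fun w => ∑ i, max (w i) 0
    let σ : EuclideanSpace ℝ k → X := fun w => (max 1 (m w))⁻¹ • ∑ i, max (w i) 0 • (i : X)
    have hm : Continuous m := by fun_prop
    have hσ : Continuous σ := by
      refine Continuous.smul (Continuous.inv₀ (by fun_prop) fun w => ?_) (by fun_prop)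
      have : 1 ≤ max 1 (m w) := le_max_left _ _
      positivity
    have hσR : ∀ w, σ w ∈ Metric.closedBall (0 : X) R := by
      intro w
      have h1 : 0 < max 1 (m w) := lt_of_lt_of_le one_pos (le_max_left _ _)
      rw [mem_closedBall_zero_iff, norm_smul, norm_inv, Real.norm_of_nonneg h1.le,
        inv_mul_le_iff₀ h1]
      calc ‖∑ i, max (w i) 0 • (i : X)‖ ≤ ∑ i, ‖max (w i) 0 • (i : X)‖ := norm_sum_le _ _
        _ ≤ ∑ i, max (w i) 0 * R := by
            refine Finset.sum_le_sum fun i _ => ?_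
            rw [norm_smul, Real.norm_of_nonneg (le_max_right _ _)]
            gcongr
            simpa using hSR (hkS i.2)
        _ = m w * R := by rw [Finset.sum_mul]
        _ ≤ max 1 (m w) * R := by gcongr; exact le_max_right _ _
    let φ : k → X → ℝ := fun i y => max 0 (ε - ‖y - i‖)
    have hφ0 : ∀ i y, 0 ≤ φ i y := fun i y => le_max_left _ _
    have hφpos : ∀ y ∈ S, 0 < ∑ i, φ i y := by
      intro y hy
      obtain ⟨i, hi, hyi⟩ := mem_iUnion₂.1 (hcover hy)
      rw [Metric.mem_ball, dist_eq_norm] at hyi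
      exact Finset.sum_pos' (fun i _ => hφ0 i y) ⟨⟨i, hi⟩, Finset.mem_univ _,
        lt_max_of_lt_right (sub_pos.2 hyi)⟩
    have hTσS : ∀ w, T (σ w) ∈ S := fun w => hmaps (hσR w)
    have hTσ : Continuous fun w => T (σ w) := hT.comp_continuous hσ hσR
    let f : EuclideanSpace ℝ k → EuclideanSpace ℝ k := fun w =>
      WithLp.toLp 2 fun i => φ i (T (σ w)) / ∑ j, φ j (T (σ w))
    have hf : Continuous f := by
      refine (PiLp.continuous_toLp 2 _).comp (continuous_pi fun i => ?_)
      have hφ : ∀ j, Continuous fun w => φ j (T (σ w)) := fun j =>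
        continuous_const.max (continuous_const.sub (hTσ.sub continuous_const).norm)
      exact (hφ i).div (continuous_finsetSum _ fun j _ => hφ j) fun w => (hφpos _ (hTσS w)).ne'
    have hf0 : ∀ w i, 0 ≤ f w i := fun w i => div_nonneg (hφ0 _ _) (hφpos _ (hTσS w)).le
    have hf1 : ∀ w, ∑ i, f w i = 1 := fun w => by
      simp only [f]
      rw [← Finset.sum_div, div_self (hφpos _ (hTσS w)).ne']
    have hfn : ∀ w, ‖f w‖ ≤ 1 := by
      intro w
      rw [EuclideanSpace.norm_eq, Real.sqrt_le_iff, one_pow]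
      refine ⟨zero_le_one, ?_⟩
      conv_rhs => rw [← hf1 w]
      refine Finset.sum_le_sum fun i _ => ?_
      have : f w i ≤ 1 := by
        rw [← hf1 w]
        exact Finset.single_le_sum (fun j _ => hf0 w j) (Finset.mem_univ i)
      rw [Real.norm_of_nonneg (hf0 w i)]
      nlinarith [hf0 w i]
    obtain ⟨w, hw⟩ := exists_fixedPoint_of_continuous_of_norm_le_one hf hfn
    have hw0 : ∀ i, 0 ≤ w i := fun i => hw ▸ hf0 w i
    have hw1 : ∑ i, w i = 1 := by
      have := hf1 w
      rwa [hw] at this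
    have hσw : σ w = ∑ i, w i • (i : X) := by
      simp only [σ, m, max_eq_left (hw0 _), hw1, max_self, inv_one, one_smul]
    refine ⟨σ w, hσR w, ?_⟩
    have h1 : T (σ w) - σ w = ∑ i, w i • (T (σ w) - i) := by
      simp only [smul_sub, Finset.sum_sub_distrib, ← Finset.sum_smul, hw1, one_smul]
      rw [← hσw]
    rw [h1]
    calc ‖∑ i, w i • (T (σ w) - i)‖ ≤ ∑ i, ‖w i • (T (σ w) - i)‖ := norm_sum_le _ _
      _ ≤ ∑ i, w i * ε := by
          refine Finset.sum_le_sum fun i _ => ?_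
          rw [norm_smul, Real.norm_of_nonneg (hw0 i)]
          by_cases h : ‖T (σ w) - i‖ ≤ ε
          · have := hw0 i
            gcongr
          · have : w i = 0 := by
              have h2 : f w i = 0 := by
                have : φ i (T (σ w)) = 0 := max_eq_left (by linarith)
                simp only [f, this, zero_div]
              rwa [hw] at h2
            simp [this]
      _ = ε := by rw [← Finset.sum_mul, hw1, one_mul]
  choose x hxR hx using fun n : ℕ => happrox (1 / ((n : ℝ) + 1)) Nat.one_div_pos_of_nat
  obtain ⟨z, hzS, ψ, hψ, hz⟩ := hS.tendsto_subseq fun n => hmaps (hxR n)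
  have hdiff : Tendsto (fun n => T (x (ψ n)) - x (ψ n)) atTop (nhds 0) := by
    refine squeeze_zero_norm (fun n => hx (ψ n)) ?_
    exact tendsto_one_div_add_atTop_nhds_zero_nat.comp hψ.tendsto_atTop
  have hxz : Tendsto (fun n => x (ψ n)) atTop (nhds z) := by
    simpa using hz.sub hdiff
  have hTz : Tendsto (fun n => T (x (ψ n))) atTop (nhds (T z)) :=
    (hT z (hSR hzS)).tendsto.comp (tendsto_nhdsWithin_iff.2
      ⟨hxz, Eventually.of_forall fun n => hxR (ψ n)⟩)
  exact ⟨z, hSR hzS, tendsto_nhds_unique hTz hz⟩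

theorem isCompact_setOf_norm_le_of_norm_sub_le_dist {X F : Type*} [TopologicalSpace X]
    [CompactSpace X] [NormedAddCommGroup F] [ProperSpace F] (M : ℝ) {N : X → ℝ}
    (hN : Continuous N) :
    IsCompact {y : C(X, F) | ‖y‖ ≤ M ∧ ∀ s t, ‖y s - y t‖ ≤ dist (N s) (N t)} := by
  rcases lt_or_ge M 0 with hM | hM
  · convert isCompact_empty (X := C(X, F))
    refine Set.eq_empty_of_forall_notMem fun y hy => ?_
    linarith [norm_nonneg y, hy.1]
  have hmod : ∀ f : X → F, (∀ s t, ‖f s - f t‖ ≤ dist (N s) (N t)) → Continuous f := by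
    intro f hf
    refine continuous_iff_continuousAt.2 fun t => ?_
    rw [ContinuousAt, tendsto_iff_norm_sub_tendsto_zero]
    refine squeeze_zero (fun _ => norm_nonneg _) (fun s => hf s t) ?_
    exact tendsto_iff_dist_tendsto_zero.1 hN.continuousAt
  apply ArzelaAscoli.isCompact_of_equicontinuous
  · have himg : ContinuousMap.toFun '' {y : C(X, F) | ‖y‖ ≤ M ∧
        ∀ s t, ‖y s - y t‖ ≤ dist (N s) (N t)} =
        (Set.univ.pi fun _ => Metric.closedBall 0 M) ∩
          {f | ∀ s t, ‖f s - f t‖ ≤ dist (N s) (N t)} := by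
      ext f
      constructor
      · rintro ⟨y, ⟨hy1, hy2⟩, rfl⟩
        refine ⟨fun t _ => ?_, hy2⟩
        exact mem_closedBall_zero_iff.2 ((y.norm_coe_le_norm t).trans hy1)
      · rintro ⟨hf1, hf2⟩
        refine ⟨⟨f, hmod f hf2⟩, ⟨?_, hf2⟩, rfl⟩
        exact (ContinuousMap.norm_le _ hM).2 fun t =>
          mem_closedBall_zero_iff.1 (hf1 t (Set.mem_univ t))
    rw [himg]
    refine (isCompact_univ_pi fun _ => isCompact_closedBall 0 M).inter_right ?_
    simp only [Set.ofPred_forall]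
    exact isClosed_iInter fun s => isClosed_iInter fun t =>
      isClosed_le (by fun_prop) continuous_const
  · intro t
    rw [Metric.equicontinuousAt_iff_right]
    intro ε hε
    filter_upwards [hN.continuousAt.eventually (Metric.ball_mem_nhds (N t) hε)] with s hs y
    rw [dist_eq_norm]
    exact (y.2.2 t s).trans_lt (Metric.mem_ball'.1 hs)

section Primitive

variable {a b : ℝ} {F : Type*} [NormedAddCommGroup F] [NormedSpace ℝ F]

/-- The primitive of an integrable function on `[a, b]` vanishing at `a`. -/
noncomputable def intervalPrimitive (hab : a ≤ b) (q : ℝ → F)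
    (hq : IntervalIntegrable q volume a b) : C(Set.Icc a b, F) where
  toFun t := ∫ s in a..(t : ℝ), q s
  continuous_toFun := by
    have h := continuousOn_primitive_interval' hq Set.left_mem_uIcc
    rw [Set.uIcc_of_le hab] at h
    exact continuousOn_iff_continuous_domRestrict.1 h

theorem intervalPrimitive_apply (hab : a ≤ b) (q : ℝ → F)
    (hq : IntervalIntegrable q volume a b) (t : Set.Icc a b) :
    intervalPrimitive hab q hq t = ∫ s in a..(t : ℝ), q s := rfl

omit [NormedSpace ℝ F] in
theorem IntervalIntegrable.mono_Icc {q : ℝ → F} (hab : a ≤ b)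
    (hq : IntervalIntegrable q volume a b) (s t : Set.Icc a b) :
    IntervalIntegrable q volume s t := by
  refine hq.mono_set ?_
  rw [Set.uIcc_of_le hab]
  exact Set.OrdConnected.uIcc_subset inferInstance s.2 t.2

theorem norm_intervalPrimitive_sub_le (hab : a ≤ b) {q : ℝ → F}
    (hq : IntervalIntegrable q volume a b) {m : ℝ → ℝ} (hm : IntervalIntegrable m volume a b)
    (hqm : ∀ s ∈ Set.Icc a b, ‖q s‖ ≤ m s) (s t : Set.Icc a b) :
    ‖intervalPrimitive hab q hq s - intervalPrimitive hab q hq t‖ ≤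
      dist (intervalPrimitive hab m hm s) (intervalPrimitive hab m hm t) := by
  let ta : Set.Icc a b := ⟨a, Set.left_mem_Icc.2 hab⟩
  rw [Real.dist_eq]
  simp only [intervalPrimitive_apply]
  rw [integral_interval_sub_left (a := a) (hq.mono_Icc hab ta s) (hq.mono_Icc hab ta t),
    integral_interval_sub_left (a := a) (hm.mono_Icc hab ta s) (hm.mono_Icc hab ta t)]
  refine norm_integral_le_abs_of_norm_le ?_ (hm.mono_Icc hab t s)
  refine (ae_restrict_iff' measurableSet_uIoc).2 (Eventually.of_forall fun r hr => hqm r ?_)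
  exact Set.OrdConnected.uIcc_subset inferInstance t.2 s.2 (Set.uIoc_subset_uIcc hr)

theorem norm_intervalPrimitive_le (hab : a ≤ b) {q : ℝ → F}
    (hq : IntervalIntegrable q volume a b) {m : ℝ → ℝ} (hm : IntervalIntegrable m volume a b)
    (hqm : ∀ s ∈ Set.Icc a b, ‖q s‖ ≤ m s) :
    ‖intervalPrimitive hab q hq‖ ≤ ∫ s in a..b, m s := by
  have hm0 : ∀ s ∈ Set.Icc a b, 0 ≤ m s := fun s hs => (norm_nonneg _).trans (hqm s hs)
  refine (ContinuousMap.norm_le _ (integral_nonneg hab hm0)).2 fun t => ?_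
  refine (intervalIntegral.norm_integral_le_integral_norm t.2.1).trans ?_
  let ta : Set.Icc a b := ⟨a, Set.left_mem_Icc.2 hab⟩
  refine (integral_mono_on t.2.1 (hq.mono_Icc hab ta t).norm (hm.mono_Icc hab ta t)
    fun s hs => hqm s ⟨hs.1, hs.2.trans t.2.2⟩).trans ?_
  refine integral_mono_interval le_rfl t.2.1 t.2.2 ?_ hm
  exact (ae_restrict_iff' measurableSet_Ioc).2 (Eventually.of_forall fun r hr =>
    hm0 r ⟨hr.1.le, hr.2⟩)

end Primitive

theorem exists_solution_linear_bvp {a b : ℝ} (hab : a ≤ b) {F : Type*} [NormedAddCommGroup F]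
    [NormedSpace ℝ F] [FiniteDimensional ℝ F] {P : C(Set.Icc a b, F) → ℝ → F}
    {L : C(Set.Icc a b, F) → F} {m : ℝ → ℝ} {M : ℝ} (hP : IsLinearMap ℝ P)
    (hL : IsLinearMap ℝ L) (hPint : ∀ y, IntervalIntegrable (P y) volume a b)
    (hm : IntervalIntegrable m volume a b) (hm0 : ∀ t ∈ Set.Icc a b, 0 ≤ m t)
    (hPm : ∀ y, ∀ t ∈ Set.Icc a b, ‖P y t‖ ≤ m t * ‖y‖)
    (hM : 0 ≤ M) (hLM : ∀ y, ‖L y‖ ≤ M * ‖y‖)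
    (huniq : ∀ y : C(Set.Icc a b, F), (∀ t : Set.Icc a b, y t = y ⟨a, Set.left_mem_Icc.2 hab⟩ +
      ∫ s in a..(t : ℝ), P y s) → L y = 0 → y = 0)
    {q : ℝ → F} (hq : IntervalIntegrable q volume a b) (c : F) :
    ∃ y : C(Set.Icc a b, F), (∀ t : Set.Icc a b, y t = y ⟨a, Set.left_mem_Icc.2 hab⟩ +
      ∫ s in a..(t : ℝ), (P y s + q s)) ∧ L y = c := by
  have : ProperSpace F := FiniteDimensional.proper ℝ F
  have : CompleteSpace F := FiniteDimensional.complete ℝ F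
  let ta : Set.Icc a b := ⟨a, Set.left_mem_Icc.2 hab⟩
  let K₀ : C(Set.Icc a b, F) →ₗ[ℝ] C(Set.Icc a b, F) :=
    { toFun := fun y => ContinuousMap.const _ (y ta - L y) + intervalPrimitive hab (P y) (hPint y)
      map_add' := fun y z => by
        ext t
        have h1 : ∫ s in a..(t : ℝ), P (y + z) s =
            (∫ s in a..(t : ℝ), P y s) + ∫ s in a..(t : ℝ), P z s := by
          rw [← integral_add ((hPint y).mono_Icc hab ta t) ((hPint z).mono_Icc hab ta t), hP.map_add]
          rfl
        simp only [ContinuousMap.add_apply, ContinuousMap.const_apply, intervalPrimitive_apply,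
          h1, hL.map_add]
        abel
      map_smul' := fun r y => by
        ext t
        have h1 : ∫ s in a..(t : ℝ), P (r • y) s = r • ∫ s in a..(t : ℝ), P y s := by
          rw [← intervalIntegral.integral_smul, hP.map_smul]
          rfl
        simp only [ContinuousMap.add_apply, ContinuousMap.smul_apply, ContinuousMap.const_apply,
          intervalPrimitive_apply, h1, hL.map_smul, smul_add, smul_sub,
          RingHom.id_apply] }
  have hcompact : ∀ y, ‖y‖ ≤ 1 → K₀ y ∈ {z : C(Set.Icc a b, F) |
      ‖z‖ ≤ 1 + M + ∫ s in a..b, m s ∧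
      ∀ s t, ‖z s - z t‖ ≤ dist (intervalPrimitive hab m hm s) (intervalPrimitive hab m hm t)} := by
    intro y hy
    have hPy : ∀ s ∈ Set.Icc a b, ‖P y s‖ ≤ m s := fun s hs =>
      (hPm y s hs).trans (mul_le_of_le_one_right (hm0 s hs) hy)
    constructor
    · refine (norm_add_le _ _).trans (add_le_add ?_ (norm_intervalPrimitive_le hab _ hm hPy))
      refine (ContinuousMap.norm_le _ (by positivity)).2 fun t => ?_
      refine (norm_sub_le _ _).trans (add_le_add ((y.norm_coe_le_norm _).trans hy) ?_)
      exact (hLM y).trans (mul_le_of_le_one_right hM hy)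
    · intro s t
      have : K₀ y s - K₀ y t = intervalPrimitive hab (P y) (hPint y) s -
          intervalPrimitive hab (P y) (hPint y) t := by
        simp [K₀]
      rw [this]
      exact norm_intervalPrimitive_sub_le hab _ hm hPy s t
  have hK₀ : ∀ y, ‖K₀ y‖ ≤ (1 + M + ∫ s in a..b, m s) * ‖y‖ := by
    intro y
    rcases eq_or_ne y 0 with rfl | hy
    · simp
    · have hy0 : 0 < ‖y‖ := norm_pos_iff.2 hy
      have h1 := (hcompact (‖y‖⁻¹ • y) (by
        rw [norm_smul, norm_inv, norm_norm, inv_mul_cancel₀ hy0.ne'])).1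
      rwa [map_smul, norm_smul, norm_inv, norm_norm, inv_mul_le_iff₀ hy0, mul_comm] at h1
  let K : C(Set.Icc a b, F) →L[ℝ] C(Set.Icc a b, F) := K₀.mkContinuous _ hK₀
  have hKc : IsCompactOperator K :=
    ⟨_, isCompact_setOf_norm_le_of_norm_sub_le_dist (1 + M + ∫ s in a..b, m s)
      (intervalPrimitive hab m hm).continuous, by
        filter_upwards [Metric.closedBall_mem_nhds (0 : C(Set.Icc a b, F)) one_pos] with y hy
        exact hcompact y (mem_closedBall_zero_iff.1 hy)⟩
  have hKapply : ∀ y t, K y t = y ta - L y + ∫ s in a..(t : ℝ), P y s := fun y t => rfl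
  have hunit : IsUnit (algebraMap ℝ (C(Set.Icc a b, F) →L[ℝ] C(Set.Icc a b, F)) 1 - K) := by
    rcases hKc.hasEigenvalue_or_mem_resolventSet one_ne_zero with h | h
    · obtain ⟨y, hy⟩ := h.exists_hasEigenvector
      have hKy : K y = y := by simpa using hy.apply_eq_smul
      have hLy : L y = 0 := by
        have h1 := hKapply y ta
        simp only [ta, integral_same, add_zero] at h1
        rw [hKy] at h1
        exact sub_eq_self.1 h1.symm
      refine absurd (huniq y (fun t => ?_) hLy) hy.2
      have h1 := hKapply y t
      rwa [hKy, hLy, sub_zero] at h1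
    · exact h
  obtain ⟨V, hV⟩ := hunit.exists_right_inv
  let f := ContinuousMap.const (Set.Icc a b) c + intervalPrimitive hab q hq
  have hy : V f - K (V f) = f := by
    have := DFunLike.congr_fun hV f
    simpa using this
  have hyt : ∀ t : Set.Icc a b, V f t - (V f ta - L (V f) + ∫ s in a..(t : ℝ), P (V f) s) =
      c + ∫ s in a..(t : ℝ), q s := fun t => DFunLike.congr_fun hy t
  have hL : L (V f) = c := by
    have := hyt ta
    simp only [ta, integral_same, add_zero] at this
    simpa using this
  refine ⟨V f, fun t => ?_, hL⟩
  rw [integral_add ((hPint _).mono_Icc hab ta t) (hq.mono_Icc hab ta t)]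
  have := hyt t
  rw [hL, sub_eq_iff_eq_add] at this
  rw [this]
  abel

theorem integral_norm_add_le {a b : ℝ} (hab : a ≤ b) {F : Type*} [NormedAddCommGroup F]
    {u v w : ℝ → F} (hu : IntervalIntegrable u volume a b) (hv : IntervalIntegrable v volume a b)
    (hw : IntervalIntegrable w volume a b) (h : ∀ t, ‖w t‖ ≤ ‖u t‖ + ‖v t‖) :
    ∫ t in a..b, ‖w t‖ ≤ (∫ t in a..b, ‖u t‖) + ∫ t in a..b, ‖v t‖ := by
  rw [← integral_add hu.norm hv.norm]
  exact integral_mono_on hab hw.norm (hu.norm.add hv.norm) fun t _ => h t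

theorem tendsto_integral_norm_sub_of_add {a b : ℝ} (hab : a ≤ b) {X F : Type*}
    [NormedAddCommGroup F] {l : Filter X} {u v w : X → ℝ → F}
    (hu : ∀ x, IntervalIntegrable (u x) volume a b)
    (hv : ∀ x, IntervalIntegrable (v x) volume a b)
    (hw : ∀ x, IntervalIntegrable (w x) volume a b)
    (h : ∀ x t, ‖w x t‖ ≤ ‖u x t‖ + ‖v x t‖)
    (hu0 : Tendsto (fun x => ∫ t in a..b, ‖u x t‖) l (nhds 0))
    (hv0 : Tendsto (fun x => ∫ t in a..b, ‖v x t‖) l (nhds 0)) :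
    Tendsto (fun x => ∫ t in a..b, ‖w x t‖) l (nhds 0) := by
  refine squeeze_zero (fun x => integral_nonneg hab fun t _ => norm_nonneg _)
    (fun x => integral_norm_add_le hab (hu x) (hv x) (hw x) (h x)) ?_
  simpa using hu0.add hv0

theorem tendsto_integral_norm_smul_sub {a b : ℝ} (hab : a ≤ b) {X F : Type*} [TopologicalSpace X]
    [NormedAddCommGroup F] [NormedSpace ℝ F] {d : X → ℝ} {w : X → ℝ → F} {x₀ : X}
    (hd : ContinuousAt d x₀) (hd1 : ∀ x, ‖d x‖ ≤ 1)
    (hw : ∀ x, IntervalIntegrable (w x) volume a b)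
    (h : Tendsto (fun x => ∫ t in a..b, ‖w x t - w x₀ t‖) (nhds x₀) (nhds 0)) :
    Tendsto (fun x => ∫ t in a..b, ‖d x • w x t - d x₀ • w x₀ t‖) (nhds x₀) (nhds 0) := by
  refine tendsto_integral_norm_sub_of_add hab (u := fun x t => w x t - w x₀ t)
    (v := fun x t => (d x - d x₀) • w x₀ t) (fun x => (hw x).sub (hw x₀))
    (fun x => (hw x₀).smul _) (fun x => ((hw x).smul _).sub ((hw x₀).smul _)) (fun x t => ?_) h ?_
  · have : d x • w x t - d x₀ • w x₀ t = d x • (w x t - w x₀ t) + (d x - d x₀) • w x₀ t := by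
      rw [smul_sub, sub_smul]
      abel
    rw [this]
    refine (norm_add_le _ _).trans (add_le_add_left ?_ _)
    rw [norm_smul]
    exact mul_le_of_le_one_left (norm_nonneg _) (hd1 x)
  · simp only [norm_smul, intervalIntegral.integral_const_mul]
    have := (tendsto_iff_norm_sub_tendsto_zero.1 hd.tendsto).mul_const (∫ t in a..b, ‖w x₀ t‖)
    simpa using this

/-- Kiguradze's existence theorem for the boundary-value problem
`x' = g(x)(t)`, `h(x) = 0` on `I = [a,b]`. Here `C(I,ℝⁿ)` is modelled by
`ContinuousMap ↥(Set.Icc a b) (Fin n → ℝ)` with the sup norm, operators with values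
in `L¹(I,ℝⁿ)` are modelled by maps into `ℝ → (Fin n → ℝ)` which are interval
integrable on `[a,b]` and continuous for the `L¹`-distance, and (absolutely
continuous) solutions of the differential equations are encoded through the
equivalent integral equations. -/
theorem kiguradze_existence
    (a b : ℝ) (hab : a ≤ b) (n : ℕ) (hn : 1 ≤ n)
    (g : ContinuousMap (Set.Icc a b) (Fin n → ℝ) → ℝ → (Fin n → ℝ))
    (h : ContinuousMap (Set.Icc a b) (Fin n → ℝ) → (Fin n → ℝ))
    (p : ContinuousMap (Set.Icc a b) (Fin n → ℝ) →
      ContinuousMap (Set.Icc a b) (Fin n → ℝ) → ℝ → (Fin n → ℝ))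
    (l : ContinuousMap (Set.Icc a b) (Fin n → ℝ) →
      ContinuousMap (Set.Icc a b) (Fin n → ℝ) → (Fin n → ℝ))
    (α : ℝ → ℝ → ℝ) (α₀ : ℝ → ℝ)
    -- `g` maps `C(I,ℝⁿ)` into `L¹(I,ℝⁿ)` and is continuous
    (hg_int : ∀ x, IntervalIntegrable (g x) volume a b)
    (hg_cont : ∀ x, ∀ ε > 0, ∃ δ > 0, ∀ x', ‖x' - x‖ < δ →
      (∫ t in a..b, ‖g x' t - g x t‖) < ε)
    -- `h` is continuous
    (hh_cont : Continuous h)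
    -- for each `ρ > 0`, `sup{‖g(x)(·)‖ : ‖x‖_C ≤ ρ}` is in `L¹(I)`
    (hg_sup : ∀ ρ > 0, ∃ m : ℝ → ℝ, IntegrableOn m (Set.Icc a b) volume ∧
      ∀ x, ‖x‖ ≤ ρ → ∀ t ∈ Set.Icc a b, ‖g x t‖ ≤ m t)
    -- for each `ρ > 0`, `sup{‖h(x)‖ : ‖x‖_C ≤ ρ} < ∞`
    (hh_sup : ∀ ρ > 0, ∃ M : ℝ, ∀ x, ‖x‖ ≤ ρ → ‖h x‖ ≤ M)
    -- `p` maps into `L¹(I,ℝⁿ)` and `(p,l)` is a continuous pair of operators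
    (hp_int : ∀ x y, IntervalIntegrable (p x y) volume a b)
    (hp_cont : ∀ x y, ∀ ε > 0, ∃ δ > 0, ∀ x' y', ‖x' - x‖ < δ → ‖y' - y‖ < δ →
      (∫ t in a..b, ‖p x' y' t - p x y t‖) < ε)
    (hl_cont : Continuous fun xy :
        ContinuousMap (Set.Icc a b) (Fin n → ℝ) × ContinuousMap (Set.Icc a b) (Fin n → ℝ) =>
      l xy.1 xy.2)
    -- (1) linearity in the second argument
    (hp_lin : ∀ x, IsLinearMap ℝ (p x))
    (hl_lin : ∀ x, IsLinearMap ℝ (l x))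
    -- (2) bounds via `α` and `α₀`
    (hα_nonneg : ∀ t r, 0 ≤ α t r)
    (hα_mono : ∀ t, ∀ r s : ℝ, 0 ≤ r → r ≤ s → α t r ≤ α t s)
    (hα_int : ∀ r : ℝ, 0 ≤ r → IntegrableOn (fun t => α t r) (Set.Icc a b) volume)
    (hα₀_nonneg : ∀ r, 0 ≤ α₀ r)
    (hα₀_mono : Monotone α₀)
    (hp_bound : ∀ x y, ∀ t ∈ Set.Icc a b, ‖p x y t‖ ≤ α t ‖x‖ * ‖y‖)
    (hl_bound : ∀ x y, ‖l x y‖ ≤ α₀ ‖x‖ * ‖y‖)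
    -- (3) the a priori estimate for the linear problems
    (β : ℝ) (hβ : 0 < β)
    (h3 : ∀ x, ∀ q : ℝ → (Fin n → ℝ), IntervalIntegrable q volume a b →
      ∀ c₀ : Fin n → ℝ, ∀ y : ContinuousMap (Set.Icc a b) (Fin n → ℝ),
      (∀ t : Set.Icc a b, y t = y ⟨a, Set.left_mem_Icc.2 hab⟩ +
        ∫ s in a..(t : ℝ), (p x y s + q s)) →
      l x y = c₀ →
      ‖y‖ ≤ β * (‖c₀‖ + ∫ s in a..b, ‖q s‖))
    -- the uniform a priori bound on the homotopy problems
    (ρ : ℝ) (hρ : 0 < ρ)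
    (hom : ∀ lam : ℝ, lam ∈ Set.Ioo (0:ℝ) 1 →
      ∀ x : ContinuousMap (Set.Icc a b) (Fin n → ℝ),
      (∀ t : Set.Icc a b, x t = x ⟨a, Set.left_mem_Icc.2 hab⟩ +
        ∫ s in a..(t : ℝ), (p x x s + lam • (g x s - p x x s))) →
      l x x = lam • (l x x - h x) →
      ‖x‖ ≤ ρ) :
    ∃ x : ContinuousMap (Set.Icc a b) (Fin n → ℝ),
      (∀ t : Set.Icc a b, x t = x ⟨a, Set.left_mem_Icc.2 hab⟩ +
        ∫ s in a..(t : ℝ), g x s) ∧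
      h x = 0 := by
  let C := ContinuousMap (Set.Icc a b) (Fin n → ℝ)
  let ta : Set.Icc a b := ⟨a, Set.left_mem_Icc.2 hab⟩
  let δ : C → ℝ := fun x => max 0 (min 1 (2 - ‖x‖ / ρ))
  have hδc : Continuous δ := by fun_prop
  have hδ0 : ∀ x, 0 ≤ δ x := fun x => le_max_left _ _
  have hδ1 : ∀ x, δ x ≤ 1 := fun x => max_le zero_le_one (min_le_left _ _)
  have hδn : ∀ x, ‖δ x‖ ≤ 1 := fun x => by rw [Real.norm_of_nonneg (hδ0 x)]; exact hδ1 x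
  have hδlarge : ∀ x : C, 2 * ρ ≤ ‖x‖ → δ x = 0 := fun x hx => by
    have : 2 ≤ ‖x‖ / ρ := (le_div_iff₀ hρ).2 hx
    exact max_eq_left ((min_le_right _ _).trans (by linarith))
  have hδsmall : ∀ x : C, ‖x‖ ≤ ρ → δ x = 1 := fun x hx => by
    have : ‖x‖ / ρ ≤ 1 := (div_le_one hρ).2 hx
    have h2 : min 1 (2 - ‖x‖ / ρ) = 1 := min_eq_left (by linarith)
    simp only [δ, h2, max_eq_right zero_le_one]
  have hδmid : ∀ x : C, ρ < ‖x‖ → ‖x‖ < 2 * ρ → δ x ∈ Set.Ioo (0 : ℝ) 1 := fun x h1 h2 => by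
    have h3 : 1 < ‖x‖ / ρ := (one_lt_div hρ).2 h1
    have h4 : ‖x‖ / ρ < 2 := (div_lt_iff₀ hρ).2 h2
    exact ⟨lt_max_of_lt_right (lt_min one_pos (by linarith)),
      max_lt one_pos ((min_le_right _ _).trans_lt (by linarith))⟩
  have hαii : ∀ r : ℝ, 0 ≤ r → IntervalIntegrable (fun t => α t r) volume a b := fun r hr =>
    (intervalIntegrable_iff_integrableOn_Icc_of_le hab).2 (hα_int r hr)
  let w : C → ℝ → Fin n → ℝ := fun x t => g x t - p x x t
  have hw : ∀ x, IntervalIntegrable (w x) volume a b := fun x => (hg_int x).sub (hp_int x x)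
  let q : C → ℝ → Fin n → ℝ := fun x t => δ x • w x t
  have hq : ∀ x, IntervalIntegrable (q x) volume a b := fun x => (hw x).smul (δ x)
  let c : C → Fin n → ℝ := fun x => δ x • (l x x - h x)
  have hc : Continuous c :=
    hδc.smul ((hl_cont.comp (continuous_id.prodMk continuous_id)).sub hh_cont)
  -- uniform bounds on the right-hand sides
  obtain ⟨m, hm_int, hm⟩ := hg_sup (2 * ρ) (by positivity)
  obtain ⟨M, hM⟩ := hh_sup (2 * ρ) (by positivity)
  have hmii : IntervalIntegrable m volume a b :=
    (intervalIntegrable_iff_integrableOn_Icc_of_le hab).2 hm_int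
  have hM0 : 0 ≤ M := (norm_nonneg _).trans (hM 0 (by simp [hρ.le]))
  have hm0 : ∀ t ∈ Set.Icc a b, 0 ≤ m t := fun t ht =>
    (norm_nonneg _).trans (hm 0 (by simp [hρ.le]) t ht)
  let μ : ℝ → ℝ := fun t => m t + α t (2 * ρ) * (2 * ρ)
  have hμ : IntervalIntegrable μ volume a b := hmii.add ((hαii _ (by positivity)).mul_const _)
  have hqμ : ∀ x, ∀ t ∈ Set.Icc a b, ‖q x t‖ ≤ μ t := by
    intro x t ht
    rcases le_total (2 * ρ) ‖x‖ with hx | hx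
    · simp only [q, hδlarge x hx, zero_smul, norm_zero]
      have := hm0 t ht
      have := hα_nonneg t (2 * ρ)
      positivity
    · rw [norm_smul]
      refine (mul_le_of_le_one_left (norm_nonneg _) (hδn x)).trans ((norm_sub_le _ _).trans ?_)
      refine add_le_add (hm x hx t ht) ((hp_bound x x t ht).trans ?_)
      exact mul_le_mul (hα_mono t _ _ (norm_nonneg _) hx) hx (norm_nonneg _) (hα_nonneg _ _)
  let Mc : ℝ := α₀ (2 * ρ) * (2 * ρ) + M
  have hMc0 : 0 ≤ Mc := by
    have := hα₀_nonneg (2 * ρ)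
    positivity
  have hcM : ∀ x, ‖c x‖ ≤ Mc := by
    intro x
    rcases le_total (2 * ρ) ‖x‖ with hx | hx
    · simpa only [c, hδlarge x hx, zero_smul, norm_zero] using hMc0
    · rw [norm_smul]
      refine (mul_le_of_le_one_left (norm_nonneg _) (hδn x)).trans ((norm_sub_le _ _).trans ?_)
      refine add_le_add ((hl_bound x x).trans ?_) (hM x hx)
      exact mul_le_mul (hα₀_mono hx) hx (norm_nonneg _) (hα₀_nonneg _)
  -- the solution operator of the linear problems
  have hsolve : ∀ x, ∃ y : C, (∀ t : Set.Icc a b, y t = y ta +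
      ∫ s in a..(t : ℝ), (p x y s + q x s)) ∧ l x y = c x := by
    intro x
    refine exists_solution_linear_bvp hab (hp_lin x) (hl_lin x) (hp_int x)
      (hαii ‖x‖ (norm_nonneg _)) (fun t _ => hα_nonneg _ _) (hp_bound x) (hα₀_nonneg ‖x‖)
      (hl_bound x) (fun y hy hLy => ?_) (hq x) (c x)
    have := h3 x 0 IntervalIntegrable.zero 0 y (by simpa using hy) hLy
    simpa using this
  choose Y hYeq hYl using hsolve
  let R : ℝ := β * (Mc + ∫ t in a..b, μ t)
  have hμ0 : 0 ≤ ∫ t in a..b, μ t :=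
    integral_nonneg hab fun t ht => (norm_nonneg _).trans (hqμ 0 t ht)
  have hR : 0 ≤ R := by positivity
  have hYR : ∀ x, ‖Y x‖ ≤ R := by
    intro x
    refine (h3 x (q x) (hq x) (c x) (Y x) (hYeq x) (hYl x)).trans ?_
    refine mul_le_mul_of_nonneg_left (add_le_add (hcM x) ?_) hβ.le
    exact integral_mono_on hab (hq x).norm hμ (hqμ x)
  have hwc : ∀ x₀, Tendsto (fun x => ∫ t in a..b, ‖w x t - w x₀ t‖) (nhds x₀) (nhds 0) := by
    intro x₀
    refine tendsto_integral_norm_sub_of_add hab (u := fun x t => g x t - g x₀ t)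
      (v := fun x t => p x x t - p x₀ x₀ t) (fun x => (hg_int x).sub (hg_int x₀))
      (fun x => (hp_int x x).sub (hp_int x₀ x₀)) (fun x => (hw x).sub (hw x₀))
      (fun x t => ?_) ?_ ?_
    · have : w x t - w x₀ t = (g x t - g x₀ t) - (p x x t - p x₀ x₀ t) := by
        simp only [w]
        abel
      rw [this]
      exact norm_sub_le _ _
    · refine Metric.tendsto_nhds_nhds.2 fun ε hε => ?_
      obtain ⟨η, hη, H⟩ := hg_cont x₀ ε hε
      refine ⟨η, hη, fun x hx => ?_⟩
      rw [Real.dist_0_eq_abs, abs_of_nonneg (integral_nonneg hab fun t _ => norm_nonneg _)]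
      exact H x (by rwa [← dist_eq_norm])
    · refine Metric.tendsto_nhds_nhds.2 fun ε hε => ?_
      obtain ⟨η, hη, H⟩ := hp_cont x₀ x₀ ε hε
      refine ⟨η, hη, fun x hx => ?_⟩
      rw [Real.dist_0_eq_abs, abs_of_nonneg (integral_nonneg hab fun t _ => norm_nonneg _)]
      rw [dist_eq_norm] at hx
      exact H x x hx hx
  have hYc : Continuous Y := by
    refine continuous_iff_continuousAt.2 fun x₀ => ?_
    let e : C → ℝ → Fin n → ℝ := fun x s => (p x (Y x₀) s - p x₀ (Y x₀) s) + (q x s - q x₀ s)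
    have he : ∀ x, IntervalIntegrable (e x) volume a b := fun x =>
      ((hp_int _ _).sub (hp_int _ _)).add ((hq x).sub (hq x₀))
    have hest : ∀ x, ‖Y x - Y x₀‖ ≤
        β * (‖c x - l x (Y x₀)‖ + ∫ s in a..b, ‖e x s‖) := by
      intro x
      refine h3 x (e x) (he x) _ _ (fun t => ?_) (by rw [(hl_lin x).map_sub, hYl])
      have h1 : ∫ s in a..(t : ℝ), (p x (Y x - Y x₀) s + e x s) =
          (∫ s in a..(t : ℝ), (p x (Y x) s + q x s)) -
            ∫ s in a..(t : ℝ), (p x₀ (Y x₀) s + q x₀ s) := by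
        rw [← integral_sub (((hp_int _ _).add (hq x)).mono_Icc hab ta t)
          (((hp_int _ _).add (hq x₀)).mono_Icc hab ta t)]
        refine integral_congr fun s _ => ?_
        simp only [(hp_lin x).map_sub, Pi.sub_apply, e]
        abel
      rw [h1, ContinuousMap.sub_apply, ContinuousMap.sub_apply, hYeq x t, hYeq x₀ t]
      simp only [ta]
      abel
    rw [ContinuousAt, tendsto_iff_norm_sub_tendsto_zero]
    refine squeeze_zero (fun _ => norm_nonneg _) hest ?_
    have h1 : Tendsto (fun x => ‖c x - l x (Y x₀)‖) (nhds x₀) (nhds 0) := by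
      have : Continuous fun x => ‖c x - l x (Y x₀)‖ :=
        (hc.sub (hl_cont.comp (continuous_id.prodMk continuous_const))).norm
      have h2 := this.tendsto x₀
      rwa [hYl, sub_self, norm_zero] at h2
    have h2 : Tendsto (fun x => ∫ s in a..b, ‖e x s‖) (nhds x₀) (nhds 0) := by
      refine tendsto_integral_norm_sub_of_add hab
        (u := fun x s => p x (Y x₀) s - p x₀ (Y x₀) s) (v := fun x s => q x s - q x₀ s)
        (fun x => (hp_int _ _).sub (hp_int _ _)) (fun x => (hq x).sub (hq x₀)) he
        (fun x t => norm_add_le _ _) ?_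
        (tendsto_integral_norm_smul_sub hab hδc.continuousAt hδn hw (hwc x₀))
      refine Metric.tendsto_nhds_nhds.2 fun ε hε => ?_
      obtain ⟨η, hη, H⟩ := hp_cont x₀ (Y x₀) ε hε
      refine ⟨η, hη, fun x hx => ?_⟩
      rw [Real.dist_0_eq_abs, abs_of_nonneg (integral_nonneg hab fun t _ => norm_nonneg _)]
      exact H x (Y x₀) (by rwa [← dist_eq_norm]) (by simpa using hη)
    simpa using (h1.add h2).const_mul β
  -- the solution operator has a fixed point
  let ν : ℝ → ℝ := fun t => α t R * R + μ t
  have hν : IntervalIntegrable ν volume a b := ((hαii R hR).mul_const _).add hμ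
  obtain ⟨x, -, hx⟩ := exists_fixedPoint_of_continuousOn_closedBall hR hYc.continuousOn
    (isCompact_setOf_norm_le_of_norm_sub_le_dist (F := Fin n → ℝ) R
      (intervalPrimitive hab ν hν).continuous)
    (fun y hy => mem_closedBall_zero_iff.2 hy.1) (fun x hx => ⟨hYR x, fun s t => by
      have hi := (hp_int x (Y x)).add (hq x)
      have h1 : Y x s - Y x t =
          intervalPrimitive hab _ hi s - intervalPrimitive hab _ hi t := by
        rw [hYeq x s, hYeq x t]
        exact add_sub_add_left_eq_sub _ _ _
      rw [h1]
      refine norm_intervalPrimitive_sub_le hab hi hν (fun r hr => ?_) s t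
      refine (norm_add_le _ _).trans (add_le_add ((hp_bound _ _ r hr).trans ?_) (hqμ x r hr))
      exact mul_le_mul (hα_mono r _ _ (norm_nonneg _) (mem_closedBall_zero_iff.1 hx)) (hYR x)
        (norm_nonneg _) (hα_nonneg _ _)⟩)
  have hxeq := hYeq x
  have hxl := hYl x
  rw [hx] at hxeq hxl
  have hxρ : ‖x‖ ≤ ρ := by
    by_contra! hlt
    rcases lt_or_ge ‖x‖ (2 * ρ) with h2 | h2
    · exact hlt.not_ge (hom (δ x) (hδmid x hlt h2) x hxeq hxl)
    · have := h3 x (q x) (hq x) (c x) x hxeq hxl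
      simp only [c, q, hδlarge x h2, zero_smul, norm_zero, intervalIntegral.integral_zero,
        add_zero, mul_zero] at this
      linarith
  refine ⟨x, fun t => ?_, ?_⟩
  · have := hxeq t
    simpa only [q, w, hδsmall x hxρ, one_smul, add_sub_cancel] using this
  · simp only [c, hδsmall x hxρ, one_smul] at hxl
    exact sub_eq_self.1 hxl.symm
end
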